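/- arXiv:1605.02715 — 9 statements merged into one kernel-verified Lean document; each statement's English description precedes it below -/
import Mathlib

section
/- Kac's formula without ergodicity: for every measurable set D ∈ 𝒜, the first entry index n_D is finite μ-almost everywhere on D, and ∫_D n_D(y) dμ(y) = μ(Z_D^1), where the integral is taken in [0,∞]. -/
open MeasureTheory Set Filter
open scoped ENNReal ENat

/-- The first entry index `n_D(y) = inf {n ≥ 1 : Tⁿ y ∈ D} ∈ ℕ ∪ {∞}`, with `inf ∅ = ∞`. -/
noncomputable def entryIdx {Y : Type*} (T : Y → Y) (D : Set Y) (y : Y) : ℕ∞ :=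
  sInf {m : ℕ∞ | ∃ n : ℕ, 1 ≤ n ∧ T^[n] y ∈ D ∧ m = n}

/-- The set where the entry index exceeds `k`. -/
def kacU {Y : Type*} (T : Y → Y) (D : Set Y) (k : ℕ) : Set Y :=
  {y | ∀ j : ℕ, 1 ≤ j → j ≤ k → T^[j] y ∉ D}

theorem kac_pointwise {Y : Type*} (T : Y → Y) (D : Set Y) (y : Y) :
    (entryIdx T D y : ℝ≥0∞) = ∑' k, (kacU T D k).indicator (fun _ => (1 : ℝ≥0∞)) y := by
  classical
  by_cases h : ∃ n : ℕ, 1 ≤ n ∧ T^[n] y ∈ D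
  · have h1 := Nat.find_spec h
    have h2 : ∀ m, 1 ≤ m → T^[m] y ∈ D → Nat.find h ≤ m := fun m a b => Nat.find_min' h ⟨a, b⟩
    generalize Nat.find h = N at h1 h2
    have he : entryIdx T D y = N := by
      apply le_antisymm
      · exact sInf_le ⟨N, h1.1, h1.2, rfl⟩
      · refine le_sInf ?_
        rintro m ⟨n, hn, hn', rfl⟩
        exact_mod_cast h2 n hn hn'
    have hU : ∀ k, y ∈ kacU T D k ↔ k < N := by
      intro k
      constructor
      · intro hk
        by_contra hc
        exact hk N h1.1 (by omega) h1.2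
      · intro hk j hj hjk hjD
        have := h2 j hj hjD
        omega
    rw [he, tsum_eq_sum (s := Finset.range N)]
    · rw [Finset.sum_congr rfl (g := fun _ => (1 : ℝ≥0∞))]
      · simp
      · intro k hk
        exact indicator_of_mem ((hU k).2 (Finset.mem_range.1 hk)) _
    · intro k hk
      exact indicator_of_notMem (fun hh => hk (Finset.mem_range.2 ((hU k).1 hh))) _
  · have he : entryIdx T D y = ⊤ := by
      refine sInf_eq_top.2 ?_
      rintro m ⟨n, hn, hn', rfl⟩
      exact (h ⟨n, hn, hn'⟩).elim
    have : ∀ k, (kacU T D k).indicator (fun _ => (1 : ℝ≥0∞)) y = 1 := fun k =>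
      indicator_of_mem (show y ∈ kacU T D k from fun j hj _ hjD => h ⟨j, hj, hjD⟩) _
    simp only [he, this]
    rw [ENNReal.tsum_const_eq_top_of_ne_zero one_ne_zero]
    rfl

/-- Kac's formula without ergodicity: the first entry index `n_D` is finite `μ`-a.e. on `D`,
and `∫_D n_D dμ = μ(Z_D^1)` where `Z_D^1 = ⋃_{j ≥ 1} T⁻ʲ D`. -/
theorem kac_formula_without_ergodicity
    {Y : Type*} [MeasurableSpace Y] (μ : Measure Y) [IsProbabilityMeasure μ]
    (T : Y → Y) (hT : MeasurePreserving T μ μ)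
    (D : Set Y) (hD : MeasurableSet D) :
    (∀ᵐ y ∂μ, y ∈ D → entryIdx T D y ≠ ⊤) ∧
    ∫⁻ y in D, (entryIdx T D y : ℝ≥0∞) ∂μ
      = μ (⋃ (j : ℕ) (_ : 1 ≤ j), T^[j] ⁻¹' D) := by
  have hit : ∀ j, MeasurableSet (T^[j] ⁻¹' D) := fun j => (hT.measurable.iterate j) hD
  have hUm : ∀ k, MeasurableSet (kacU T D k) := by
    intro k
    have : kacU T D k = ⋂ (j : ℕ) (_ : 1 ≤ j) (_ : j ≤ k), (T^[j] ⁻¹' D)ᶜ := by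
      ext y; simp [kacU]
    rw [this]
    exact MeasurableSet.iInter fun j => MeasurableSet.iInter fun _ =>
      MeasurableSet.iInter fun _ => (hit j).compl
  have hanti : ∀ k l, k ≤ l → kacU T D l ⊆ kacU T D k := fun k l hkl y hy j hj hjk =>
    hy j hj (hjk.trans hkl)
  have hpre : ∀ k, T ⁻¹' (kacU T D k \ D) = kacU T D (k+1) := by
    intro k
    ext y
    constructor
    · rintro ⟨h1, h2⟩ j hj hjk
      obtain ⟨i, rfl⟩ : ∃ i, j = i + 1 := ⟨j - 1, by omega⟩
      rw [Function.iterate_succ_apply]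
      rcases Nat.eq_zero_or_pos i with rfl | hi
      · exact h2
      · exact h1 i hi (by omega)
    · intro h
      refine ⟨fun j hj hjk => ?_, ?_⟩
      · have := h (j+1) (by omega) (by omega)
        rwa [Function.iterate_succ_apply] at this
      · exact h 1 le_rfl (by omega)
  have hE : ∀ k, μ (kacU T D k ∩ D) = μ (kacU T D k \ kacU T D (k+1)) := by
    intro k
    have a1 := measure_inter_add_diff (μ := μ) (kacU T D k) hD
    have a2 := measure_diff_add_inter (μ := μ) (kacU T D k) (hUm (k+1))
    rw [inter_eq_right.2 (hanti k (k+1) (by omega)), ← hpre k,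
      hT.measure_preimage ((hUm k).diff hD).nullMeasurableSet, hpre k, ← a1] at a2
    exact ((ENNReal.add_left_inj (measure_ne_top μ _)).1 a2).symm
  have hZ : (⋃ (j : ℕ) (_ : 1 ≤ j), T^[j] ⁻¹' D) = ⋃ k, kacU T D k \ kacU T D (k+1) := by
    classical
    ext y
    simp only [mem_iUnion, mem_preimage, exists_prop]
    constructor
    · intro h
      have h1 := Nat.find_spec h
      have h2 : ∀ m, 1 ≤ m → T^[m] y ∈ D → Nat.find h ≤ m :=
        fun m a b => Nat.find_min' h ⟨a, b⟩
      generalize Nat.find h = N at h1 h2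
      refine ⟨N - 1, fun j hj hjk hjD => ?_, fun hh => hh N h1.1 (by omega) h1.2⟩
      have := h2 j hj hjD
      omega
    · rintro ⟨k, -, h⟩
      by_contra hc
      exact h fun j hj _ hjD => hc ⟨j, hj, hjD⟩
  have hdis : Pairwise (Function.onFun Disjoint fun k => kacU T D k \ kacU T D (k+1)) := by
    have key : ∀ k l, k < l →
        Disjoint (kacU T D k \ kacU T D (k+1)) (kacU T D l \ kacU T D (l+1)) := by
      intro k l hkl
      rw [Set.disjoint_left]
      rintro y ⟨_, h⟩ ⟨h', _⟩
      exact h (hanti (k+1) l hkl h')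
    intro k l hkl
    rcases lt_or_gt_of_ne hkl with h | h
    · exact key k l h
    · exact (key l k h).symm
  have hmi : ∀ k, Measurable ((kacU T D k).indicator (fun _ => (1 : ℝ≥0∞))) := fun k =>
    measurable_const.indicator (hUm k)
  have hI : ∫⁻ y in D, (entryIdx T D y : ℝ≥0∞) ∂μ
      = μ (⋃ (j : ℕ) (_ : 1 ≤ j), T^[j] ⁻¹' D) := by
    simp only [kac_pointwise]
    rw [lintegral_tsum fun k => (hmi k).aemeasurable, hZ,
      measure_iUnion hdis fun k => (hUm k).diff (hUm (k+1))]
    refine tsum_congr fun k => ?_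
    rw [← hE k, lintegral_indicator_const (hUm k), one_mul, Measure.restrict_apply (hUm k)]
  refine ⟨?_, hI⟩
  have hm : Measurable fun y => (entryIdx T D y : ℝ≥0∞) := by
    simp only [kac_pointwise]
    exact Measurable.ennreal_tsum hmi
  have hfin := ae_lt_top hm (μ := μ.restrict D) (by rw [hI]; exact measure_ne_top μ _)
  filter_upwards [(ae_restrict_iff' hD).1 hfin] with y hy hyD h
  have := hy hyD
  simp [h] at this
end

section
/- Kac's formula for suspension semi-flows without ergodicity: for every measurable set D ∈ 𝒜, the quantity S_{n_D(y)}(y) (the first return time of (y,0) to the section D × {0} under the suspension semi-flow with roof function r) satisfies ∫_D S_{n_D(y)}(y) dμ(y) = ∫_{Z_D^1} r dμ, both sides being finite. -/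
open MeasureTheory Set Filter
open scoped ENNReal ENat

/-- The Birkhoff sum `S_n(y) = ∑_{j=0}^{n-1} r(Tʲ y)`. -/
noncomputable def birkhoff {Y : Type*} (T : Y → Y) (r : Y → ℝ) (n : ℕ) (y : Y) : ℝ :=
  ∑ j ∈ Finset.range n, r (T^[j] y)

/-- The Birkhoff sum `S_n(y)` with extended index `n ∈ ℕ ∪ {∞}`, interpreted as `+∞`
when `n = ∞` (values in `[0,∞]`; for `0 < inf r` all finite Birkhoff sums are nonnegative). -/
noncomputable def birkhoffE {Y : Type*} (T : Y → Y) (r : Y → ℝ) (n : ℕ∞) (y : Y) : ℝ≥0∞ :=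
  if n = ⊤ then ⊤ else ENNReal.ofReal (birkhoff T r n.toNat y)

lemma kac_lt_entryIdx {Y : Type*} (T : Y → Y) (D : Set Y) (y : Y) (j : ℕ) :
    (j : ℕ∞) < entryIdx T D y ↔ ∀ i, 1 ≤ i → i ≤ j → T^[i] y ∉ D := by
  unfold entryIdx
  constructor
  · intro h i h1 hij hi
    have : sInf {m : ℕ∞ | ∃ n : ℕ, 1 ≤ n ∧ T^[n] y ∈ D ∧ m = n} ≤ (i : ℕ∞) :=
      sInf_le ⟨i, h1, hi, rfl⟩
    have h2 := lt_of_lt_of_le h this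
    have h3 : j < i := by exact_mod_cast h2
    omega
  · intro h
    have h2 : ((j + 1 : ℕ) : ℕ∞) ≤ sInf {m : ℕ∞ | ∃ n : ℕ, 1 ≤ n ∧ T^[n] y ∈ D ∧ m = n} := by
      apply le_sInf
      rintro m ⟨n, h1, hn, rfl⟩
      have : j + 1 ≤ n := by
        by_contra hlt
        exact h n h1 (by omega) hn
      exact_mod_cast this
    refine lt_of_lt_of_le ?_ h2
    exact_mod_cast Nat.lt_succ_self j

lemma kac_birkhoffE {Y : Type*} (T : Y → Y) (r : Y → ℝ)
    (c : ℝ) (hc : 0 < c) (hcr : ∀ y, c ≤ r y) (n : ℕ∞) (y : Y) :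
    birkhoffE T r n y = ∑' j : ℕ, (if (j : ℕ∞) < n then ENNReal.ofReal (r (T^[j] y)) else 0) := by
  unfold birkhoffE
  induction n using ENat.recTopCoe with
  | top =>
    simp only [if_true, ENat.coe_lt_top]
    symm
    rw [eq_top_iff, ← ENNReal.tsum_const_eq_top_of_ne_zero (α := ℕ) (c := ENNReal.ofReal c) (by simpa using hc)]
    exact ENNReal.tsum_le_tsum fun j => ENNReal.ofReal_le_ofReal (hcr _)
  | coe n =>
    simp only [ENat.coe_ne_top, if_false, ENat.toNat_coe, Nat.cast_lt]
    rw [tsum_eq_sum (s := Finset.range n) (by intro b hb; simp at hb; simp [hb])]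
    unfold birkhoff
    rw [ENNReal.ofReal_sum_of_nonneg (fun i _ => hc.le.trans (hcr _))]
    refine Finset.sum_congr rfl fun i hi => ?_
    simp [Finset.mem_range.1 hi]

/-- points avoiding `D` at times `1..j` -/
def kacA {Y : Type*} (T : Y → Y) (D : Set Y) (j : ℕ) : Set Y :=
  {y | ∀ i, 1 ≤ i → i ≤ j → T^[i] y ∉ D}

/-- points avoiding `D` at times `0..j` -/
def kacC {Y : Type*} (T : Y → Y) (D : Set Y) (j : ℕ) : Set Y :=
  {y | ∀ i, i ≤ j → T^[i] y ∉ D}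

lemma kacA_meas {Y : Type*} [MeasurableSpace Y] {T : Y → Y} (hT : Measurable T) {D : Set Y}
    (hD : MeasurableSet D) (j : ℕ) : MeasurableSet (kacA T D j) := by
  have : kacA T D j = ⋂ (i : ℕ) (_ : 1 ≤ i) (_ : i ≤ j), (T^[i] ⁻¹' D)ᶜ := by
    ext y; simp [kacA]
  rw [this]
  exact MeasurableSet.iInter fun i => MeasurableSet.iInter fun _ => MeasurableSet.iInter fun _ =>
    ((hT.iterate i) hD).compl

lemma kacC_eq {Y : Type*} (T : Y → Y) (D : Set Y) (j : ℕ) : kacC T D j = kacA T D j \ D := by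
  ext y
  simp only [kacC, kacA, mem_diff, mem_setOf_eq]
  constructor
  · exact fun h => ⟨fun i _ hi => h i hi, h 0 (Nat.zero_le _)⟩
  · rintro ⟨h, h0⟩ i hi
    rcases Nat.eq_zero_or_pos i with rfl | hp
    · exact h0
    · exact h i hp hi

lemma kacA_succ {Y : Type*} (T : Y → Y) (D : Set Y) (j : ℕ) :
    kacA T D (j + 1) = T ⁻¹' kacC T D j := by
  ext y
  simp only [kacC, kacA, mem_preimage, mem_setOf_eq, ← Function.iterate_succ_apply]
  constructor
  · exact fun h i hi => h (i + 1) (by omega) (by omega)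
  · intro h i h1 hi
    obtain ⟨k, rfl⟩ : ∃ k, i = k + 1 := ⟨i - 1, by omega⟩
    exact h k (by omega)

lemma kacC_meas {Y : Type*} [MeasurableSpace Y] {T : Y → Y} (hT : Measurable T) {D : Set Y}
    (hD : MeasurableSet D) (j : ℕ) : MeasurableSet (kacC T D j) := by
  rw [kacC_eq]; exact (kacA_meas hT hD j).diff hD

lemma kac_partial {Y : Type*} [MeasurableSpace Y] (μ : Measure Y)
    {T : Y → Y} (hT : MeasurePreserving T μ μ) {D : Set Y} (hD : MeasurableSet D)
    {E : Set Y} (hE : MeasurableSet E) (n : ℕ) :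
    ∑ j ∈ Finset.range (n + 1), μ ((T^[j] ⁻¹' E) ∩ (kacA T D j ∩ D))
      + μ (kacC T D n ∩ T^[n] ⁻¹' E) = μ E := by
  have key : ∀ j, μ ((T^[j] ⁻¹' E) ∩ (kacA T D j ∩ D)) + μ (kacC T D j ∩ T^[j] ⁻¹' E)
      = μ (kacA T D j ∩ T^[j] ⁻¹' E) := by
    intro j
    rw [← measure_inter_add_diff (kacA T D j ∩ T^[j] ⁻¹' E) hD, kacC_eq]
    congr 2 <;> (ext y; simp only [mem_inter_iff, mem_diff]; tauto)
  induction n with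
  | zero =>
    simp only [zero_add, Finset.range_one, Finset.sum_singleton]
    rw [key 0]
    congr 1
    ext y
    simp only [kacA, mem_inter_iff, mem_setOf_eq, mem_preimage, Function.iterate_zero, id]
    constructor
    · exact fun h => h.2
    · exact fun h => ⟨fun i h1 h0 => by omega, h⟩
  | succ n ih =>
    rw [Finset.sum_range_succ, add_assoc, key (n + 1), ← ih]
    congr 1
    rw [kacA_succ, Function.iterate_succ, preimage_comp, ← preimage_inter]
    exact hT.measure_preimage
      ((kacC_meas hT.measurable hD n).inter ((hT.measurable.iterate n) hE)).nullMeasurableSet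

/-- The set of points whose orbit visits `D`. -/
def kacZ {Y : Type*} (T : Y → Y) (D : Set Y) : Set Y := ⋃ (j : ℕ) (_ : 1 ≤ j), T^[j] ⁻¹' D

lemma mem_kacZ {Y : Type*} (T : Y → Y) (D : Set Y) (y : Y) :
    y ∈ kacZ T D ↔ ∃ j, 1 ≤ j ∧ T^[j] y ∈ D := by simp [kacZ]

lemma kacZ_meas {Y : Type*} [MeasurableSpace Y] {T : Y → Y} (hT : Measurable T) {D : Set Y}
    (hD : MeasurableSet D) : MeasurableSet (kacZ T D) :=
  MeasurableSet.iUnion fun i => MeasurableSet.iUnion fun _ => (hT.iterate i) hD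

lemma kac_tsum_sub {Y : Type*} [MeasurableSpace Y] (μ : Measure Y) [IsProbabilityMeasure μ]
    {T : Y → Y} (hT : MeasurePreserving T μ μ) {D : Set Y} (hD : MeasurableSet D)
    {E : Set Y} (hE : MeasurableSet E) (hEZ : E ⊆ kacZ T D) :
    ∑' j, μ ((T^[j] ⁻¹' E) ∩ (kacA T D j ∩ D)) = μ E := by
  have h1 : Tendsto (fun n => μ (kacC T D n ∩ kacZ T D)) atTop (nhds 0) := by
    have h := tendsto_measure_iInter_atTop (μ := μ) (s := fun n => kacC T D n ∩ kacZ T D)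
      (fun n => ((kacC_meas hT.measurable hD n).inter
        (kacZ_meas hT.measurable hD)).nullMeasurableSet)
      (fun a b hab y hy => ⟨fun i hi => hy.1 i (hi.trans hab), hy.2⟩)
      ⟨0, measure_ne_top _ _⟩
    have he : ⋂ n, kacC T D n ∩ kacZ T D = ∅ := by
      rw [eq_empty_iff_forall_notMem]
      intro y hy
      rw [mem_iInter] at hy
      obtain ⟨j, _, hj⟩ := (mem_kacZ T D y).1 (hy 0).2
      exact (hy j).1 j le_rfl hj
    rwa [he, measure_empty] at h
  have h2 : Tendsto (fun n => μ (kacC T D n ∩ T^[n] ⁻¹' E)) atTop (nhds 0) := by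
    refine tendsto_of_tendsto_of_tendsto_of_le_of_le tendsto_const_nhds h1
      (fun _ => zero_le) (fun n => measure_mono ?_)
    rintro y ⟨hy, hyE⟩
    obtain ⟨j, hj, hjD⟩ := (mem_kacZ T D _).1 (hEZ hyE)
    refine ⟨hy, (mem_kacZ T D y).2 ⟨j + n, by omega, ?_⟩⟩
    rwa [Function.iterate_add_apply]
  have h3 := ((ENNReal.tendsto_nat_tsum
    (fun j => μ ((T^[j] ⁻¹' E) ∩ (kacA T D j ∩ D)))).comp (tendsto_add_atTop_nat 1)).add h2
  have h4 : Tendsto (fun _ : ℕ => μ E) atTop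
      (nhds (∑' j, μ ((T^[j] ⁻¹' E) ∩ (kacA T D j ∩ D)) + 0)) :=
    h3.congr fun n => kac_partial μ hT hD hE n
  rw [add_zero] at h4
  exact tendsto_nhds_unique h4 tendsto_const_nhds

lemma kac_null {Y : Type*} [MeasurableSpace Y] (μ : Measure Y) [IsProbabilityMeasure μ]
    {T : Y → Y} (hT : MeasurePreserving T μ μ) {D : Set Y} (hD : MeasurableSet D) (j : ℕ) :
    μ ((T^[j] ⁻¹' (kacZ T D)ᶜ) ∩ (kacA T D j ∩ D)) = 0 := by
  have h := hT.conservative.ae_mem_imp_frequently_image_mem hD.nullMeasurableSet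
  refine measure_mono_null ?_ (ae_iff.1 h)
  rintro y ⟨hy, _, hyD⟩ hcon
  obtain ⟨n, hn, hnD⟩ := frequently_atTop.1 (hcon hyD) (j + 1)
  refine hy ((mem_kacZ T D _).2 ⟨n - j, by omega, ?_⟩)
  rw [← Function.iterate_add_apply, Nat.sub_add_cancel (by omega)]
  exact hnD

lemma kac_measure {Y : Type*} [MeasurableSpace Y] (μ : Measure Y) [IsProbabilityMeasure μ]
    {T : Y → Y} (hT : MeasurePreserving T μ μ) {D : Set Y} (hD : MeasurableSet D) :
    Measure.sum (fun j : ℕ => (μ.restrict (kacA T D j ∩ D)).map T^[j])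
      = μ.restrict (kacZ T D) := by
  ext E hE
  have hZ := kacZ_meas hT.measurable hD
  rw [Measure.sum_apply _ hE, Measure.restrict_apply hE,
    ← kac_tsum_sub μ hT hD (hE.inter hZ) inter_subset_right]
  congr 1
  ext j
  rw [Measure.map_apply (hT.measurable.iterate j) hE,
    Measure.restrict_apply ((hT.measurable.iterate j) hE)]
  refine le_antisymm ?_ (measure_mono ?_)
  · calc _ ≤ μ ((T^[j] ⁻¹' (E ∩ kacZ T D)) ∩ (kacA T D j ∩ D)
        ∪ (T^[j] ⁻¹' (kacZ T D)ᶜ) ∩ (kacA T D j ∩ D)) := by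
          refine measure_mono ?_
          intro y hy
          simp only [mem_union, mem_inter_iff, mem_preimage, mem_compl_iff] at hy ⊢
          tauto
      _ ≤ _ := measure_union_le _ _
      _ = _ := by rw [kac_null μ hT hD j, add_zero]
  · exact inter_subset_inter_left _ (preimage_mono inter_subset_left)

/-- Kac's formula for suspension semi-flows without ergodicity:
`∫_D S_{n_D(y)}(y) dμ(y) = ∫_{Z_D^1} r dμ`, both sides being finite. -/
theorem kac_formula_suspension_without_ergodicity
    {Y : Type*} [MeasurableSpace Y] (μ : Measure Y) [IsProbabilityMeasure μ]
    (T : Y → Y) (hT : MeasurePreserving T μ μ)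
    (r : Y → ℝ) (hrm : Measurable r) (hri : Integrable r μ)
    (c : ℝ) (hc : 0 < c) (hcr : ∀ y, c ≤ r y)
    (D : Set Y) (hD : MeasurableSet D) :
    ∫⁻ y in D, birkhoffE T r (entryIdx T D y) y ∂μ
        = ∫⁻ y in ⋃ (j : ℕ) (_ : 1 ≤ j), T^[j] ⁻¹' D, ENNReal.ofReal (r y) ∂μ ∧
      ∫⁻ y in D, birkhoffE T r (entryIdx T D y) y ∂μ ≠ ⊤ := by
  have hf : Measurable fun y => ENNReal.ofReal (r y) := hrm.ennreal_ofReal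
  have hmain : ∫⁻ y in D, birkhoffE T r (entryIdx T D y) y ∂μ
      = ∫⁻ y in ⋃ (j : ℕ) (_ : 1 ≤ j), T^[j] ⁻¹' D, ENNReal.ofReal (r y) ∂μ := by
    change _ = ∫⁻ y in kacZ T D, ENNReal.ofReal (r y) ∂μ
    rw [← kac_measure μ hT hD, lintegral_sum_measure]
    have hpt : ∀ y, birkhoffE T r (entryIdx T D y) y
        = ∑' j : ℕ, (kacA T D j).indicator (fun y => ENNReal.ofReal (r (T^[j] y))) y := by
      intro y
      rw [kac_birkhoffE T r c hc hcr]
      refine tsum_congr fun j => ?_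
      classical
      rw [indicator_apply]
      exact if_congr (kac_lt_entryIdx T D y j) rfl rfl
    simp_rw [hpt]
    have hfj : ∀ j : ℕ, Measurable fun y => ENNReal.ofReal (r (T^[j] y)) :=
      fun j => hf.comp (hT.measurable.iterate j)
    rw [lintegral_tsum fun j =>
      ((hfj j).indicator (kacA_meas hT.measurable hD j)).aemeasurable]
    refine tsum_congr fun j => ?_
    rw [lintegral_indicator (kacA_meas hT.measurable hD j),
      Measure.restrict_restrict (kacA_meas hT.measurable hD j),
      lintegral_map hf (hT.measurable.iterate j)]
  refine ⟨hmain, ?_⟩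
  rw [hmain]
  refine ne_top_of_le_ne_top ?_ (setLIntegral_le_lintegral _ _)
  exact hri.lintegral_lt_top.ne
end

section
/- Exact intensity of the entry-time point process (intensity part of Proposition 'stationarity'): for every measurable set D ∈ 𝒜 and every real R ≥ 0, ∫_Y ∫_0^{r(y)} #{n ≥ 1 : T^n y ∈ D and S_n(y) ≤ s + R} ds dμ(y) = R · μ(D), where # denotes cardinality (the inner count is finite for every y and s since S_n(y) ≥ n · inf r). -/
open MeasureTheory Set Filter
open scoped ENNReal

lemma birkhoff_succ_aux {Y : Type*} (T : Y → Y) (r : Y → ℝ) (n : ℕ) (y : Y) :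
    birkhoff T r (n + 1) y = r y + birkhoff T r n (T y) := by
  unfold birkhoff
  rw [Finset.sum_range_succ']
  simp [Function.iterate_succ_apply, add_comm]

lemma birkhoff_meas_aux {Y : Type*} [MeasurableSpace Y] (T : Y → Y) (hT : Measurable T)
    (r : Y → ℝ) (hr : Measurable r) (n : ℕ) : Measurable (birkhoff T r n) := by
  unfold birkhoff
  exact Finset.measurable_sum _ (fun j _ => hr.comp (hT.iterate j))

lemma birkhoff_lb_aux {Y : Type*} (T : Y → Y) (r : Y → ℝ) (c : ℝ) (hcr : ∀ y, c ≤ r y)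
    (n : ℕ) (y : Y) : n * c ≤ birkhoff T r n y := by
  unfold birkhoff
  have := Finset.card_nsmul_le_sum (Finset.range n) (fun j => r (T^[j] y)) c (fun j _ => hcr _)
  simpa using this

lemma encard_aux (P : ℕ → Prop) [DecidablePred P] :
    ({n : ℕ | 1 ≤ n ∧ P n}.encard : ℝ≥0∞) = ∑' n : ℕ, (if P (n + 1) then 1 else 0) := by
  classical
  rw [← ENNReal.tsum_set_one, tsum_subtype {n : ℕ | 1 ≤ n ∧ P n} (fun _ => (1 : ℝ≥0∞)),
    tsum_eq_zero_add' ENNReal.summable]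
  simp [Set.indicator_apply]

lemma inner_aux (a b R : ℝ) (ha : 0 ≤ a) (hb : 0 ≤ b) :
    (∫⁻ s in Set.Ico (0 : ℝ) a, (if a + b ≤ s + R then 1 else 0 : ℝ≥0∞))
      + ENNReal.ofReal (R - (a + b)) = ENNReal.ofReal (R - b) := by
  have h1 : (fun s : ℝ => (if a + b ≤ s + R then 1 else 0 : ℝ≥0∞))
      = (Set.Ici (a + b - R)).indicator 1 := by
    ext s
    simp [Set.indicator_apply, sub_le_iff_le_add]
  rw [h1, lintegral_indicator_one measurableSet_Ici, Measure.restrict_apply measurableSet_Ici]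
  have h2 : Set.Ici (a + b - R) ∩ Set.Ico 0 a = Set.Ico (max (a + b - R) 0) a := by
    ext s; simp; tauto
  rw [h2, Real.volume_Ico]
  rcases le_total (a + b - R) 0 with h | h
  · rw [max_eq_right h, ← ENNReal.ofReal_add (by linarith) (by linarith)]
    congr 1; ring
  · rw [max_eq_left h, ENNReal.ofReal_of_nonpos (p := R - (a + b)) (by linarith), add_zero]
    congr 1; ring

theorem entry_process_intensity
    {Y : Type*} [MeasurableSpace Y] (μ : Measure Y) [IsProbabilityMeasure μ]
    (T : Y → Y) (hT : MeasurePreserving T μ μ)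
    (r : Y → ℝ) (hrm : Measurable r) (hri : Integrable r μ)
    (c : ℝ) (hc : 0 < c) (hcr : ∀ y, c ≤ r y)
    (D : Set Y) (hD : MeasurableSet D) (R : ℝ) (hR : 0 ≤ R) :
    ∫⁻ y, (∫⁻ s in Set.Ico (0 : ℝ) (r y),
        ({n : ℕ | 1 ≤ n ∧ T^[n] y ∈ D ∧ birkhoff T r n y ≤ s + R}.encard : ℝ≥0∞) ∂volume) ∂μ
      = ENNReal.ofReal R * μ D := by
  classical
  have hBm := birkhoff_meas_aux T hT.measurable r hrm
  have hB0 : ∀ n y, 0 ≤ birkhoff T r n y := fun n y =>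
    le_trans (by positivity) (birkhoff_lb_aux T r c hcr n y)
  -- the density of the n-th term
  let f : ℕ → Y → ℝ≥0∞ := fun n y =>
    (T^[n] ⁻¹' D).indicator (fun y => ENNReal.ofReal (R - birkhoff T r n y)) y
  have hfm : ∀ n, Measurable (f n) := fun n =>
    (ENNReal.measurable_ofReal.comp (measurable_const.sub (hBm n))).indicator
      (hT.measurable.iterate n hD)
  let g : ℕ → Y → ℝ≥0∞ := fun n y => ∫⁻ s in Set.Ico (0 : ℝ) (r y),
    (if T^[n+1] y ∈ D ∧ birkhoff T r (n+1) y ≤ s + R then 1 else 0 : ℝ≥0∞)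
  have hgf : ∀ n y, g n y + f (n+1) y = f n (T y) := by
    intro n y
    by_cases h : T^[n] (T y) ∈ D
    · have := inner_aux (r y) (birkhoff T r n (T y)) R (hc.le.trans (hcr y)) (hB0 _ _)
      simpa [g, f, h, Set.indicator_apply, birkhoff_succ_aux] using this
    · simp [g, f, h, Set.indicator_apply]
  have hfin : ∀ n y, f n y ≠ ∞ := by
    intro n y
    simp only [f, Set.indicator_apply]
    split_ifs <;> simp
  have hgm : ∀ n, Measurable (g n) := by
    intro n
    have : g n = fun y => f n (T y) - f (n+1) y := by
      ext y
      rw [← hgf n y, ENNReal.add_sub_cancel_right (hfin _ _)]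
    rw [this]
    exact ((hfm n).comp hT.measurable).sub (hfm (n+1))
  have hstep : ∀ n, ∫⁻ y, g n y ∂μ + ∫⁻ y, f (n+1) y ∂μ = ∫⁻ y, f n y ∂μ := by
    intro n
    rw [← lintegral_add_left (hgm n), ← hT.lintegral_comp (hfm n)]
    simp_rw [hgf]
  have hsum : ∀ N, ∑ n ∈ Finset.range N, ∫⁻ y, g n y ∂μ + ∫⁻ y, f N y ∂μ = ∫⁻ y, f 0 y ∂μ := by
    intro N
    induction N with
    | zero => simp
    | succ N ih => rw [Finset.sum_range_succ, add_assoc, hstep, ih]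
  have hf0 : ∫⁻ y, f 0 y ∂μ = ENNReal.ofReal R * μ D := by
    simp [f, birkhoff, lintegral_indicator hD]
  have hzero : ∀ᶠ N : ℕ in atTop, ∫⁻ y, f N y ∂μ = 0 := by
    obtain ⟨M, hM⟩ := exists_nat_ge (R / c)
    filter_upwards [eventually_ge_atTop M] with N hN
    have h1 : R ≤ N * c := by
      rw [div_le_iff₀ hc] at hM
      have : (M : ℝ) ≤ N := by exact_mod_cast hN
      nlinarith
    have : f N = 0 := by
      ext y
      have h2 : R - birkhoff T r N y ≤ 0 := by
        linarith [birkhoff_lb_aux T r c hcr N y]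
      simp [f, Set.indicator_apply, ENNReal.ofReal_of_nonpos h2]
    simp [this]
  have htsum : ∑' n, ∫⁻ y, g n y ∂μ = ENNReal.ofReal R * μ D := by
    refine tendsto_nhds_unique (ENNReal.tendsto_nat_tsum _) ?_
    refine tendsto_const_nhds.congr' ?_
    filter_upwards [hzero] with N hN
    rw [← hf0, ← hsum N, hN, add_zero]
  rw [← htsum, ← lintegral_tsum (fun n => (hgm n).aemeasurable)]
  refine lintegral_congr fun y => ?_
  simp_rw [encard_aux (fun n => T^[n] y ∈ D ∧ birkhoff T r n y ≤ _ + R)]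
  rw [lintegral_tsum]
  intro n
  refine (Measurable.ite ?_ measurable_const measurable_const).aemeasurable
  exact (MeasurableSet.const _).inter
    (measurableSet_le measurable_const (measurable_id.add_const R))
end

section
/- The Palm distribution of the suspension entry-time process is the law of the return-time process (Proposition 'see', normalization-free form): for every measurable set D ∈ 𝒜 and every measurable function f : M(ℝ) → [0,∞], ∫_Y ∫_0^{r(y)} Σ_{n ≥ 1, T^n y ∈ D, s < S_n(y) ≤ s+1} f( Σ_{m ≥ 1, T^m y ∈ D, S_m(y) > S_n(y)} δ_{S_m(y) − S_n(y)} ) ds dμ(y) = ∫_D f( Σ_{n ≥ 1, T^n y ∈ D} δ_{S_n(y)} ) dμ(y), both sides taken in [0,∞]. -/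
open MeasureTheory Set Filter
open scoped ENNReal

/-- The return-time point measure `∑_{m ≥ 1, Tᵐ y ∈ D} δ_{S_m(y)}` of `y`. -/
noncomputable def returnProcess {Y : Type*} (T : Y → Y) (r : Y → ℝ) (D : Set Y)
    (y : Y) : Measure ℝ :=
  Measure.sum fun m : ℕ =>
    {m : ℕ | 1 ≤ m ∧ T^[m] y ∈ D}.indicator
      (fun m => Measure.dirac (birkhoff T r m y)) m

/-- The point measure `∑_{m ≥ 1, Tᵐ y ∈ D, S_m(y) > S_n(y)} δ_{S_m(y) − S_n(y)}`,
i.e. the entry-time measure shifted so that the `n`-th entry is at the origin,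
restricted to the future. -/
noncomputable def shiftedReturnProcess {Y : Type*} (T : Y → Y) (r : Y → ℝ) (D : Set Y)
    (y : Y) (n : ℕ) : Measure ℝ :=
  Measure.sum fun m : ℕ =>
    {m : ℕ | 1 ≤ m ∧ T^[m] y ∈ D ∧ birkhoff T r n y < birkhoff T r m y}.indicator
      (fun m => Measure.dirac (birkhoff T r m y - birkhoff T r n y)) m

section helpers

lemma tsum_shift (n : ℕ) (F G : ℕ → ℝ≥0∞) (h0 : ∀ i < n, F i = 0)
    (h1 : ∀ k, F (k + n) = G k) : ∑' m, F m = ∑' k, G k := by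
  have h := Summable.sum_add_tsum_nat_add' (f := F) (k := n) ENNReal.summable
  rw [Finset.sum_eq_zero (fun i hi => h0 i (Finset.mem_range.mp hi)), zero_add] at h
  rw [← h]
  exact tsum_congr h1

variable {Y : Type*}

lemma birkhoff_add (T : Y → Y) (r : Y → ℝ) (n k : ℕ) (y : Y) :
    birkhoff T r (k + n) y = birkhoff T r n y + birkhoff T r k (T^[n] y) := by
  unfold birkhoff
  rw [add_comm k n, Finset.sum_range_add]
  congr 1
  apply Finset.sum_congr rfl
  intro j _
  rw [add_comm n j, Function.iterate_add_apply]

lemma birkhoff_ge (T : Y → Y) (r : Y → ℝ) (c : ℝ) (hcr : ∀ y, c ≤ r y) (n : ℕ) (y : Y) :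
    n * c ≤ birkhoff T r n y := by
  unfold birkhoff
  have := Finset.card_nsmul_le_sum (Finset.range n) (fun j => r (T^[j] y)) c (fun j _ => hcr _)
  simpa using this

lemma shifted_eq (T : Y → Y) (r : Y → ℝ) (c : ℝ) (hc : 0 < c) (hcr : ∀ y, c ≤ r y)
    (D : Set Y) (y : Y) (n : ℕ) :
    shiftedReturnProcess T r D y n = returnProcess T r D (T^[n] y) := by
  ext B hB
  unfold shiftedReturnProcess returnProcess
  rw [Measure.sum_apply _ hB, Measure.sum_apply _ hB]
  refine tsum_shift n _ _ ?_ ?_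
  rotate_left
  · intro k
    have h0 := birkhoff_add T r n k y
    have h1 := birkhoff_ge T r c hcr k (T^[n] y)
    have h2 : T^[k + n] y = T^[k] (T^[n] y) := Function.iterate_add_apply _ _ _ _
    rcases Nat.eq_zero_or_pos k with rfl | hk
    · simp [Set.indicator]
    · have h3 : 0 < (k : ℝ) * c := by positivity
      have h4 : birkhoff T r n y < birkhoff T r (k + n) y := by linarith
      have h5 : birkhoff T r (k + n) y - birkhoff T r n y = birkhoff T r k (T^[n] y) := by linarith
      have h6 : 1 ≤ k + n := by omega
      have h7 : 1 ≤ k := hk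
      by_cases hd : T^[k] (T^[n] y) ∈ D
      · rw [Set.indicator_of_mem (show k + n ∈ {m : ℕ | 1 ≤ m ∧ T^[m] y ∈ D ∧
            birkhoff T r n y < birkhoff T r m y} from ⟨h6, h2 ▸ hd, h4⟩),
          Set.indicator_of_mem (show k ∈ {m : ℕ | 1 ≤ m ∧ T^[m] (T^[n] y) ∈ D} from ⟨h7, hd⟩), h5]
      · rw [Set.indicator_of_notMem (fun h => hd (by rw [← h2]; exact h.2.1)),
          Set.indicator_of_notMem (fun h => hd h.2)]
  · intro i hi'
    obtain ⟨k, rfl⟩ := Nat.exists_eq_add_of_lt hi'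
    have h0 := birkhoff_add T r i (k + 1) y
    have h1 := birkhoff_ge T r c hcr (k + 1) (T^[i] y)
    have h3 : 0 < ((k + 1 : ℕ) : ℝ) * c := by positivity
    have h4 : ¬ birkhoff T r (i + k + 1) y < birkhoff T r i y := by
      rw [show i + k + 1 = k + 1 + i by omega]
      linarith
    simp [Set.indicator, h4]

variable [MeasurableSpace Y]

lemma measurable_birkhoff (T : Y → Y) (hT : Measurable T) (r : Y → ℝ) (hr : Measurable r)
    (n : ℕ) : Measurable (birkhoff T r n) := by
  unfold birkhoff
  exact Finset.measurable_fun_sum _ fun j _ => hr.comp (hT.iterate j)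

lemma measurable_returnProcess (T : Y → Y) (hT : Measurable T) (r : Y → ℝ) (hr : Measurable r)
    (D : Set Y) (hD : MeasurableSet D) : Measurable (returnProcess T r D) := by
  apply Measure.measurable_of_measurable_coe
  intro B hB
  unfold returnProcess
  simp_rw [Measure.sum_apply _ hB]
  apply Measurable.tsum
  intro m
  by_cases hm : 1 ≤ m
  · have : (fun y => ({m : ℕ | 1 ≤ m ∧ T^[m] y ∈ D}.indicator
      (fun m => Measure.dirac (birkhoff T r m y)) m) B) =
      (T^[m] ⁻¹' D ∩ birkhoff T r m ⁻¹' B).indicator (fun _ => (1 : ℝ≥0∞)) := by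
      funext y
      by_cases h1 : T^[m] y ∈ D <;> by_cases h2 : birkhoff T r m y ∈ B <;>
        simp [Set.indicator, hm, h1, h2, Measure.dirac_apply' _ hB]
    rw [this]
    exact measurable_const.indicator
      ((hT.iterate m hD).inter (measurable_birkhoff T hT r hr m hB))
  · simp [Set.indicator, hm]

end helpers

/-- The Palm distribution of the suspension entry-time process is the law of the
return-time process (normalization-free form): for every measurable `D` and every
measurable `f : M(ℝ) → [0,∞]`,
`∫_Y ∫_0^{r(y)} ∑_{n ≥ 1, Tⁿ y ∈ D, s < S_n(y) ≤ s+1} f(∑_{m ≥ 1, Tᵐ y ∈ D, S_m(y) > S_n(y)} δ_{S_m(y)−S_n(y)}) ds dμ(y)`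
`= ∫_D f(∑_{n ≥ 1, Tⁿ y ∈ D} δ_{S_n(y)}) dμ(y)`. -/
theorem palm_is_return_law
    {Y : Type*} [MeasurableSpace Y] (μ : Measure Y) [IsProbabilityMeasure μ]
    (T : Y → Y) (hT : MeasurePreserving T μ μ)
    (r : Y → ℝ) (hrm : Measurable r) (hri : Integrable r μ)
    (c : ℝ) (hc : 0 < c) (hcr : ∀ y, c ≤ r y)
    (D : Set Y) (hD : MeasurableSet D)
    (f : Measure ℝ → ℝ≥0∞) (hf : Measurable f) :
    ∫⁻ y, (∫⁻ s in Set.Ico (0 : ℝ) (r y),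
        ∑' n : ℕ,
          {n : ℕ | 1 ≤ n ∧ T^[n] y ∈ D ∧ s < birkhoff T r n y ∧ birkhoff T r n y ≤ s + 1}.indicator
            (fun n => f (shiftedReturnProcess T r D y n)) n ∂volume) ∂μ
      = ∫⁻ y in D, f (returnProcess T r D y) ∂μ := by
  have hTm := hT.measurable
  set g : Y → ℝ≥0∞ := D.indicator (fun y => f (returnProcess T r D y)) with hg
  have hgm : Measurable g :=
    (hf.comp (measurable_returnProcess T hTm r hrm D hD)).indicator hD
  have hSm := measurable_birkhoff T hTm r hrm
  set w : ℕ → Y → ℝ≥0∞ := fun n y =>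
    ENNReal.ofReal (min 1 (birkhoff T r (n + 1) y) - min 1 (birkhoff T r n (T y))) with hw
  have hwm : ∀ n, Measurable (w n) := fun n =>
    ((measurable_const.min (hSm (n + 1))).sub
      (measurable_const.min ((hSm n).comp hTm))).ennreal_ofReal
  set A : ℕ → ℝ≥0∞ := fun n =>
    ∫⁻ y, ENNReal.ofReal (min 1 (birkhoff T r n y)) * g (T^[n] y) ∂μ with hA
  have hAm : ∀ n, Measurable fun y =>
      ENNReal.ofReal (min 1 (birkhoff T r n y)) * g (T^[n] y) := fun n =>
    ((measurable_const.min (hSm n)).ennreal_ofReal).mul (hgm.comp (hTm.iterate n))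
  have hS0 : ∀ n y, 0 ≤ birkhoff T r n y := fun n y =>
    le_trans (by positivity) (birkhoff_ge T r c hcr n y)
  have hS1 : ∀ n y, birkhoff T r (n + 1) y = r y + birkhoff T r n (T y) := fun n y => by
    rw [birkhoff_add]; simp [birkhoff]
  -- inner integral
  have inner : ∀ y, (∫⁻ s in Set.Ico (0 : ℝ) (r y),
        ∑' n : ℕ,
          {n : ℕ | 1 ≤ n ∧ T^[n] y ∈ D ∧ s < birkhoff T r n y ∧ birkhoff T r n y ≤ s + 1}.indicator
            (fun n => f (shiftedReturnProcess T r D y n)) n ∂volume)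
      = ∑' n : ℕ, w n y * g (T^[n + 1] y) := by
    intro y
    have e : ∀ s : ℝ, (∑' n : ℕ,
          {n : ℕ | 1 ≤ n ∧ T^[n] y ∈ D ∧ s < birkhoff T r n y ∧ birkhoff T r n y ≤ s + 1}.indicator
            (fun n => f (shiftedReturnProcess T r D y n)) n) =
        ∑' n : ℕ, (Set.Ico (birkhoff T r (n + 1) y - 1) (birkhoff T r (n + 1) y)).indicator
          (fun _ => g (T^[n + 1] y)) s := by
      intro s
      refine tsum_shift 1 _ _ (by intro i hi; simp at hi; simp [hi, Set.indicator]) ?_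
      intro n
      by_cases h1 : T^[n + 1] y ∈ D
      · have hgv : g (T^[n + 1] y) = f (returnProcess T r D (T^[n + 1] y)) :=
          Set.indicator_of_mem h1 _
        by_cases h2 : s < birkhoff T r (n + 1) y ∧ birkhoff T r (n + 1) y ≤ s + 1
        · rw [Set.indicator_of_mem (show n + 1 ∈ {n : ℕ | 1 ≤ n ∧ T^[n] y ∈ D ∧
            s < birkhoff T r n y ∧ birkhoff T r n y ≤ s + 1} from ⟨Nat.succ_pos n, h1, h2⟩),
            Set.indicator_of_mem (show s ∈ Set.Ico _ _ from ⟨by linarith [h2.2], h2.1⟩),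
            shifted_eq T r c hc hcr, hgv]
        · rw [Set.indicator_of_notMem (fun h => h2 h.2.2),
            Set.indicator_of_notMem (fun h => h2 ⟨h.2, by linarith [h.1]⟩)]
      · have hgv : g (T^[n + 1] y) = 0 := Set.indicator_of_notMem h1 _
        rw [Set.indicator_of_notMem (fun h => h1 h.2.1), hgv]
        simp
    simp_rw [e]
    rw [lintegral_tsum
      (fun n => (measurable_const.indicator measurableSet_Ico).aemeasurable)]
    apply tsum_congr
    intro n
    rw [lintegral_indicator_const measurableSet_Ico, Measure.restrict_apply measurableSet_Ico,
      Set.Ico_inter_Ico, Real.volume_Ico, mul_comm]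
    congr 1
    have h1 := hS1 n y
    have h2 := hS0 n (T y)
    have h3 := hcr y
    rw [hw]
    simp only
    rw [h1]
    generalize birkhoff T r n (T y) = S at *
    by_cases h : 1 ≤ S
    · rw [ENNReal.ofReal_of_nonpos, ENNReal.ofReal_of_nonpos]
      · rw [min_eq_left (by linarith), min_eq_left h]; simp
      · grind
    · congr 1
      grind
  simp_rw [inner]
  rw [lintegral_tsum (f := fun n y => w n y * g (T^[n + 1] y))
    (fun n => ((hwm n).mul (hgm.comp (hTm.iterate (n + 1)))).aemeasurable)]
  -- telescoping
  have step : ∀ n, (∫⁻ y, w n y * g (T^[n + 1] y) ∂μ) + A n = A (n + 1) := by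
    intro n
    have : A n = ∫⁻ y, ENNReal.ofReal (min 1 (birkhoff T r n (T y))) * g (T^[n + 1] y) ∂μ := by
      rw [hA]
      simp only
      rw [← hT.lintegral_comp (hAm n)]
      rfl
    rw [this, ← lintegral_add_left (f := fun y => w n y * g (T^[n + 1] y)) ((hwm n).mul (hgm.comp (hTm.iterate (n + 1))))]
    apply lintegral_congr
    intro y
    rw [← add_mul, hw]
    simp only
    have h1 := hS1 n y
    have h2 := hS0 n (T y)
    have h3 := hcr y
    rw [← ENNReal.ofReal_add, sub_add_cancel]
    · exact sub_nonneg.mpr (min_le_min le_rfl (by linarith))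
    · exact le_min zero_le_one h2
  have psum : ∀ N, ∑ n ∈ Finset.range N, (∫⁻ y, w n y * g (T^[n + 1] y) ∂μ) = A N := by
    intro N
    induction N with
    | zero => simp [hA, birkhoff]
    | succ N ih => rw [Finset.sum_range_succ, ih, add_comm, step]
  have hlim : Tendsto A atTop (nhds (∫⁻ y in D, f (returnProcess T r D y) ∂μ)) := by
    obtain ⟨N, hN⟩ := exists_nat_ge (1 / c)
    apply tendsto_const_nhds.congr'
    filter_upwards [eventually_ge_atTop N] with n hn
    rw [← lintegral_indicator hD, ← (hT.iterate n).lintegral_comp hgm]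
    apply lintegral_congr
    intro y
    have h1 : 1 ≤ birkhoff T r n y := by
      refine le_trans ?_ (birkhoff_ge T r c hcr n y)
      rw [div_le_iff₀ hc] at hN
      refine hN.trans ?_
      gcongr
    rw [min_eq_left h1]
    simp
  have h := (ENNReal.summable (f := fun n =>
    ∫⁻ y, w n y * g (T^[n + 1] y) ∂μ)).hasSum.tendsto_sum_nat
  simp_rw [psum] at h
  exact tendsto_nhds_unique h hlim
end

section
/- Palm–Khinchin equation for suspension semi-flows, concrete form: for every measurable set D ∈ 𝒜 and every real R ≥ 0, ∫_{Z_D^1} min( r(y), max(S_{n_D(y)}(y) − R, 0) ) dμ(y) = ∫_D max( S_{n_D(y)}(y) − R, 0 ) dμ(y). (The left-hand side is the invariant measure of the set of points of the suspension whose first entry time to the section D × {0} exceeds R, times ∫_Y r dμ; the right-hand side involves the first return time of points of D.) -/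
open MeasureTheory Set Filter
open scoped ENNReal ENat

/-- Points whose first entry index is `n + 1`. -/
def lev {Y : Type*} (T : Y → Y) (D : Set Y) (n : ℕ) : Set Y :=
  {y | T^[n+1] y ∈ D ∧ ∀ i < n, T^[i+1] y ∉ D}

lemma lev_eq {Y : Type*} (T : Y → Y) (D : Set Y) (n : ℕ) :
    lev T D n = (T^[n+1] ⁻¹' D) ∩ ⋂ (i : ℕ) (_ : i < n), (T^[i+1] ⁻¹' D)ᶜ := by
  ext y; simp [lev]

lemma lev_meas {Y : Type*} [MeasurableSpace Y] (T : Y → Y) (hT : Measurable T) (D : Set Y)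
    (hD : MeasurableSet D) (n : ℕ) : MeasurableSet (lev T D n) := by
  rw [lev_eq]
  refine ((hT.iterate _) hD).inter (MeasurableSet.iInter fun i => MeasurableSet.iInter fun _ => ?_)
  exact ((hT.iterate _) hD).compl

lemma lev_disj {Y : Type*} (T : Y → Y) (D : Set Y) : Pairwise (Function.onFun Disjoint (lev T D)) := by
  intro m n hmn
  rw [Function.onFun, Set.disjoint_left]
  rintro y ⟨h1, h2⟩ ⟨h3, h4⟩
  rcases lt_or_gt_of_ne hmn with h | h
  · exact h4 _ h h1
  · exact h2 _ h h3

lemma lev_union {Y : Type*} (T : Y → Y) (D : Set Y) :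
    (⋃ (j : ℕ) (_ : 1 ≤ j), T^[j] ⁻¹' D) = ⋃ n, lev T D n := by
  classical
  ext y
  simp only [mem_iUnion, mem_preimage, exists_prop]
  constructor
  · rintro ⟨j, hj, h⟩
    have hex : ∃ n, T^[n+1] y ∈ D := ⟨j - 1, by rwa [Nat.sub_add_cancel hj]⟩
    exact ⟨Nat.find hex, Nat.find_spec hex, fun i hi => Nat.find_min hex hi⟩
  · rintro ⟨n, h, -⟩
    exact ⟨n + 1, by omega, h⟩

lemma lev_succ {Y : Type*} (T : Y → Y) (D : Set Y) (n : ℕ) :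
    lev T D (n+1) = T ⁻¹' (lev T D n \ D) := by
  ext y
  simp only [lev, mem_ofPred_eq, mem_preimage, Set.mem_sdiff, ← Function.iterate_succ_apply]
  constructor
  · rintro ⟨h1, h2⟩
    exact ⟨⟨h1, fun i hi => h2 (i+1) (by omega)⟩, h2 0 (by omega)⟩
  · rintro ⟨⟨h1, h2⟩, h3⟩
    refine ⟨h1, fun i hi => ?_⟩
    cases i with
    | zero => exact h3
    | succ i => exact h2 i (by omega)

lemma entry_lev {Y : Type*} (T : Y → Y) (D : Set Y) (n : ℕ) (y : Y) (hy : y ∈ lev T D n) :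
    entryIdx T D y = ((n + 1 : ℕ) : ℕ∞) := by
  obtain ⟨h1, h2⟩ := hy
  apply le_antisymm
  · exact sInf_le ⟨n+1, by omega, h1, rfl⟩
  · refine le_sInf ?_
    rintro m ⟨k, hk, hkD, rfl⟩
    by_contra hlt
    rw [not_le, Nat.cast_lt] at hlt
    refine h2 (k-1) (by omega) ?_
    rwa [Nat.sub_add_cancel hk]

lemma be_lev {Y : Type*} (T : Y → Y) (r : Y → ℝ) (D : Set Y) (n : ℕ) (y : Y)
    (hy : y ∈ lev T D n) :
    birkhoffE T r (entryIdx T D y) y = ENNReal.ofReal (birkhoff T r (n+1) y) := by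
  rw [entry_lev T D n y hy, birkhoffE, if_neg (ENat.coe_ne_top _), ENat.toNat_coe]

lemma lev_measure {Y : Type*} [MeasurableSpace Y] (μ : Measure Y) [IsProbabilityMeasure μ]
    (T : Y → Y) (hT : MeasurePreserving T μ μ) (D : Set Y) (hD : MeasurableSet D) (j : ℕ) :
    μ.restrict (lev T D j) =
      Measure.sum (fun k => (μ.restrict (D ∩ lev T D (j + k))).map (T^[k])) := by
  have hL := lev_meas T hT.measurable D hD
  ext E hE
  rw [Measure.sum_apply _ hE, Measure.restrict_apply hE]
  have hm : ∀ k, MeasurableSet (T^[k] ⁻¹' E) := fun k => (hT.measurable.iterate k) hE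
  have e1 : ∀ k, ((μ.restrict (D ∩ lev T D (j + k))).map (T^[k])) E
      = μ ((T^[k] ⁻¹' E ∩ lev T D (j+k)) ∩ D) := by
    intro k
    rw [Measure.map_apply (hT.measurable.iterate k) hE, Measure.restrict_apply (hm k)]
    congr 1
    ext y; simp; tauto
  simp_rw [e1]
  set a : ℕ → ℝ≥0∞ := fun k => μ (T^[k] ⁻¹' E ∩ lev T D (j+k)) with ha
  have e2 : ∀ k, a k = μ ((T^[k] ⁻¹' E ∩ lev T D (j+k)) ∩ D) + a (k+1) := by
    intro k
    have : a (k+1) = μ ((T^[k] ⁻¹' E ∩ lev T D (j+k)) \ D) := by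
      rw [← hT.measure_preimage (((hm k).inter (hL _)).diff hD).nullMeasurableSet]
      simp only [ha, ← add_assoc, lev_succ]
      congr 1
      ext y
      simp [and_assoc]
    rw [this]
    exact (measure_inter_add_sdiff _ hD).symm
  have hfin : ∑' k, a (k+1) ≠ ∞ := by
    have h1 : ∑' k, a (k+1) = μ (⋃ k, T^[k+1] ⁻¹' E ∩ lev T D (j+(k+1))) := by
      rw [measure_iUnion _ (fun k => (hm _).inter (hL _))]
      intro k l hkl
      exact (lev_disj T D (show j+(k+1) ≠ j+(l+1) by omega)).mono inter_subset_right
        inter_subset_right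
    rw [h1]
    exact measure_ne_top _ _
  have h3 : a 0 + ∑' k, a (k+1)
      = (∑' k, μ ((T^[k] ⁻¹' E ∩ lev T D (j+k)) ∩ D)) + ∑' k, a (k+1) := by
    rw [← ENNReal.tsum_add, ← tsum_congr e2]
    exact (tsum_eq_zero_add' ENNReal.summable).symm
  have := (ENNReal.add_left_inj hfin).1 h3
  simpa [ha] using this

lemma alg_sum {Y : Type*} (T : Y → Y) (r : Y → ℝ) (hr : ∀ y, 0 ≤ r y) (R : ℝ) (hR : 0 ≤ R)
    (n : ℕ) : ∀ y, ∑ p ∈ Finset.HasAntidiagonal.antidiagonal n, min (ENNReal.ofReal (r (T^[p.2] y)))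
      (ENNReal.ofReal (birkhoff T r (p.1+1) (T^[p.2] y)) - ENNReal.ofReal R)
      = ENNReal.ofReal (birkhoff T r (n+1) y) - ENNReal.ofReal R := by
  induction n with
  | zero =>
    intro y
    simp [birkhoff]
  | succ n ih =>
    intro y
    rw [Finset.Nat.sum_antidiagonal_succ']
    simp only [Function.iterate_succ_apply, Function.iterate_zero, id]
    rw [ih (T y)]
    have hs : birkhoff T r (n+1+1) y = r y + birkhoff T r (n+1) (T y) := by
      rw [birkhoff, Finset.sum_range_succ']
      simp [birkhoff, add_comm]
    rw [hs]
    generalize birkhoff T r (n+1) (T y) = s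
    simp_rw [← ENNReal.ofReal_sub _ hR]
    have h0 := hr y
    rcases le_total R s with h | h
    · rw [min_eq_left (ENNReal.ofReal_le_ofReal (by linarith)),
        ← ENNReal.ofReal_add h0 (by linarith)]
      congr 1; ring
    · rw [min_eq_right (ENNReal.ofReal_le_ofReal (by linarith)),
        ENNReal.ofReal_of_nonpos (p := s - R) (by linarith), add_zero]

/-- Palm–Khinchin equation for suspension semi-flows, concrete form: for every measurable
`D` and every `R ≥ 0`,
`∫_{Z_D^1} min(r(y), max(S_{n_D(y)}(y) − R, 0)) dμ(y) = ∫_D max(S_{n_D(y)}(y) − R, 0) dμ(y)`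
(subtraction taken in `[0,∞]`, i.e. truncated at `0`). -/
theorem palm_khinchin_suspension
    {Y : Type*} [MeasurableSpace Y] (μ : Measure Y) [IsProbabilityMeasure μ]
    (T : Y → Y) (hT : MeasurePreserving T μ μ)
    (r : Y → ℝ) (hrm : Measurable r) (hri : Integrable r μ)
    (c : ℝ) (hc : 0 < c) (hcr : ∀ y, c ≤ r y)
    (D : Set Y) (hD : MeasurableSet D) (R : ℝ) (hR : 0 ≤ R) :
    ∫⁻ y in ⋃ (j : ℕ) (_ : 1 ≤ j), T^[j] ⁻¹' D,
        min (ENNReal.ofReal (r y))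
          (birkhoffE T r (entryIdx T D y) y - ENNReal.ofReal R) ∂μ
      = ∫⁻ y in D, (birkhoffE T r (entryIdx T D y) y - ENNReal.ofReal R) ∂μ := by
  have hL := lev_meas T hT.measurable D hD
  have hbm : ∀ n, Measurable (birkhoff T r n) := by
    intro n
    unfold birkhoff
    exact Finset.measurable_sum _ fun i _ => hrm.comp (hT.measurable.iterate i)
  set G : ℕ → Y → ℝ≥0∞ := fun j y => min (ENNReal.ofReal (r y))
    (ENNReal.ofReal (birkhoff T r (j+1) y) - ENNReal.ofReal R) with hG
  have hGm : ∀ j, Measurable (G j) := fun j =>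
    hrm.ennreal_ofReal.min ((hbm (j+1)).ennreal_ofReal.sub measurable_const)
  have hD' : D =ᵐ[μ] ⋃ n, D ∩ lev T D n := by
    rw [← inter_iUnion, ← lev_union]
    have := hT.conservative.ae_mem_imp_frequently_image_mem hD.nullMeasurableSet
    filter_upwards [this] with y hy
    apply propext
    change y ∈ D ↔ y ∈ D ∩ _
    refine ⟨fun h => ⟨h, ?_⟩, fun h => h.1⟩
    obtain ⟨n, hn, hnD⟩ := (frequently_atTop.1 (hy h)) 1
    simp only [mem_iUnion]
    exact ⟨n, hn, hnD⟩
  rw [setLIntegral_congr hD', lev_union, lintegral_iUnion hL (lev_disj T D),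
    lintegral_iUnion (fun n => hD.inter (hL n))
      (fun m n h => (lev_disj T D h).mono inter_subset_right inter_subset_right)]
  have e1 : ∀ j, ∫⁻ y in lev T D j, min (ENNReal.ofReal (r y))
          (birkhoffE T r (entryIdx T D y) y - ENNReal.ofReal R) ∂μ
      = ∑' k, ∫⁻ y in D ∩ lev T D (j+k), G j (T^[k] y) ∂μ := by
    intro j
    rw [setLIntegral_congr_fun (g := G j) (hL j)
      (fun y hy => by simp only [hG, be_lev T r D j y hy]),
      lev_measure μ T hT D hD j, lintegral_sum_measure]
    refine tsum_congr fun k => ?_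
    rw [lintegral_map (hGm j) (hT.measurable.iterate k)]
  have e2 : ∀ n, ∫⁻ y in D ∩ lev T D n,
        (birkhoffE T r (entryIdx T D y) y - ENNReal.ofReal R) ∂μ
      = ∑ p ∈ Finset.HasAntidiagonal.antidiagonal n, ∫⁻ y in D ∩ lev T D (p.1+p.2), G p.1 (T^[p.2] y) ∂μ := by
    intro n
    rw [setLIntegral_congr_fun
      (g := fun y => ∑ p ∈ Finset.HasAntidiagonal.antidiagonal n, G p.1 (T^[p.2] y)) (hD.inter (hL n))
      (fun y hy => by
        simp only [hG]
        rw [alg_sum T r (fun y => hc.le.trans (hcr y)) R hR n y, be_lev T r D n y hy.2]),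
      lintegral_finsetSum _ (fun p _ => (hGm p.1).comp (hT.measurable.iterate p.2))]
    refine Finset.sum_congr rfl fun p hp => ?_
    rw [Finset.HasAntidiagonal.mem_antidiagonal.1 hp]
  rw [tsum_congr e1, tsum_congr e2]
  rw [← ENNReal.tsum_prod (f := fun j k => ∫⁻ y in D ∩ lev T D (j+k), G j (T^[k] y) ∂μ),
    ← Finset.HasAntidiagonal.sigmaAntidiagonalEquivProd.tsum_eq, ENNReal.tsum_sigma']
  refine tsum_congr fun n => ?_
  rw [tsum_fintype, ← Finset.sum_coe_sort (Finset.HasAntidiagonal.antidiagonal n)]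
  rfl
end

section
/- Palm–Khinchin equations for the j-th entry and return times of suspension semi-flows, concrete form: for every measurable set D ∈ 𝒜, every integer j ≥ 1 and every real R ≥ 0, ∫_{Z_D^∞} min( r(y), max(S_{n_D^{(j)}(y)}(y) − R, 0) ) dμ(y) = ∫_D ( max(S_{n_D^{(j)}(y)}(y) − R, 0) − max(S_{n_D^{(j−1)}(y)}(y) − R, 0) ) dμ(y), the integrand on the right being nonnegative. -/
open MeasureTheory Set Filter
open scoped ENNReal ENat

/-- The successive entry indices: `n_D^{(0)}(y) = 0` and
`n_D^{(j)}(y) = inf {n > n_D^{(j−1)}(y) : Tⁿ y ∈ D} ∈ ℕ ∪ {∞}` for `j ≥ 1`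
(with `inf ∅ = ∞`). -/
noncomputable def entryIdxIter {Y : Type*} (T : Y → Y) (D : Set Y) : ℕ → Y → ℕ∞
  | 0, _ => 0
  | (j + 1), y =>
      sInf {m : ℕ∞ | ∃ n : ℕ, entryIdxIter T D j y < (n : ℕ∞) ∧ T^[n] y ∈ D ∧ m = n}

theorem pk_entry_le {Y : Type*} (T : Y → Y) (D : Set Y) (j : ℕ) (y : Y) (m : ℕ) :
    entryIdxIter T D (j+1) y ≤ (m : ℕ∞) ↔
      ∃ n : ℕ, n ≤ m ∧ entryIdxIter T D j y < (n : ℕ∞) ∧ T^[n] y ∈ D := by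
  constructor
  · intro h
    have hne : {m : ℕ∞ | ∃ n : ℕ, entryIdxIter T D j y < (n : ℕ∞) ∧ T^[n] y ∈ D ∧ m = n}.Nonempty := by
      by_contra hne
      rw [Set.not_nonempty_iff_eq_empty] at hne
      rw [entryIdxIter, hne] at h
      simp at h
    obtain ⟨n, h1, h2, h3⟩ := csInf_mem hne
    refine ⟨n, ?_, h1, h2⟩
    rw [entryIdxIter, h3] at h
    exact_mod_cast h
  · rintro ⟨n, hn, h1, h2⟩
    rw [entryIdxIter]
    refine le_trans (sInf_le (show (n : ℕ∞) ∈ _ from ⟨n, h1, h2, rfl⟩)) ?_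
    exact_mod_cast hn

theorem pk_enat_ext {a b : ℕ∞} (h : ∀ m : ℕ, a ≤ m ↔ b ≤ m) : a = b := by
  apply le_antisymm
  · induction b using ENat.recTopCoe with
    | top => exact le_top
    | coe b => exact (h b).2 le_rfl
  · induction a using ENat.recTopCoe with
    | top => exact le_top
    | coe a => exact (h a).1 le_rfl

theorem pk_add_lt (a : ℕ∞) (n : ℕ) : 1 + a < ((n + 1 : ℕ) : ℕ∞) ↔ a < n := by
  induction a using ENat.recTopCoe with
  | top => simp
  | coe a =>
    have : (1 : ℕ∞) + (a : ℕ∞) = ((1 + a : ℕ) : ℕ∞) := by push_cast; rfl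
    rw [this, Nat.cast_lt, Nat.cast_lt]; omega

theorem pk_add_le (a : ℕ∞) (n : ℕ) : 1 + a ≤ ((n + 1 : ℕ) : ℕ∞) ↔ a ≤ n := by
  induction a using ENat.recTopCoe with
  | top => simp
  | coe a =>
    have : (1 : ℕ∞) + (a : ℕ∞) = ((1 + a : ℕ) : ℕ∞) := by push_cast; rfl
    rw [this, Nat.cast_le, Nat.cast_le]; omega

open Classical in
theorem pk_entry_rec {Y : Type*} (T : Y → Y) (D : Set Y) (j : ℕ) (y : Y) :
    entryIdxIter T D (j+1) y =
      1 + (if T y ∈ D then entryIdxIter T D j (T y) else entryIdxIter T D (j+1) (T y)) := by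
  induction j with
  | zero =>
    apply pk_enat_ext
    rintro (_ | m)
    · rw [pk_entry_le]
      simp [entryIdxIter]
    · rw [pk_entry_le, pk_add_le]
      split_ifs with h
      · simp only [entryIdxIter]
        exact iff_of_true ⟨1, by omega, by simp, h⟩ (by simp)
      · rw [pk_entry_le]
        simp only [entryIdxIter]
        constructor
        · rintro ⟨n, hn, h0, hD⟩
          rcases n with _ | _ | n
          · simp at h0
          · exact absurd hD h
          · exact ⟨n+1, by omega, by simp, hD⟩
        · rintro ⟨n, hn, h0, hD⟩
          exact ⟨n+1, by omega, by simp, hD⟩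
  | succ j ih =>
    apply pk_enat_ext
    rintro (_ | m)
    · rw [pk_entry_le]
      simp
    · rw [pk_entry_le, pk_add_le, ih]
      have key : ∀ x : ℕ∞, (∃ n : ℕ, n ≤ m + 1 ∧ 1 + x < (n : ℕ∞) ∧ T^[n] y ∈ D) ↔
          ∃ n : ℕ, n ≤ m ∧ x < (n : ℕ∞) ∧ T^[n] (T y) ∈ D := by
        intro x
        constructor
        · rintro ⟨n, hn, h0, hD⟩
          rcases n with _ | n
          · simp at h0
          · exact ⟨n, by omega, (pk_add_lt x n).1 h0, hD⟩
        · rintro ⟨n, hn, h0, hD⟩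
          exact ⟨n+1, by omega, (pk_add_lt x n).2 h0, hD⟩
      rw [key]
      split_ifs with h
      · rw [pk_entry_le]
      · rw [pk_entry_le]

theorem pk_entry_mono {Y : Type*} (T : Y → Y) (D : Set Y) (j : ℕ) (y : Y) :
    entryIdxIter T D j y ≤ entryIdxIter T D (j+1) y := by
  conv_rhs => rw [entryIdxIter]
  apply le_sInf
  rintro m ⟨n, h, _, rfl⟩
  exact h.le

theorem pk_entry_fin {Y : Type*} (T : Y → Y) (D : Set Y) (y : Y)
    (hy : ∀ k : ℕ, 1 ≤ k → ∃ i, k ≤ i ∧ T^[i] y ∈ D) (j : ℕ) :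
    entryIdxIter T D j y ≠ ⊤ := by
  induction j with
  | zero => simp [entryIdxIter]
  | succ j ih =>
    obtain ⟨n, hn⟩ := ENat.ne_top_iff_exists.1 ih
    obtain ⟨i, hi, hD⟩ := hy (n+1) (by omega)
    have := (pk_entry_le T D j y i).2 ⟨i, le_rfl, by rw [← hn]; exact_mod_cast hi, hD⟩
    exact ne_top_of_le_ne_top (ENat.natCast_ne_top i) this

theorem pk_entry_meas {Y : Type*} [MeasurableSpace Y] (T : Y → Y) (hT : Measurable T)
    (D : Set Y) (hD : MeasurableSet D) (j : ℕ) : Measurable (entryIdxIter T D j) := by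
  classical
  induction j with
  | zero => exact measurable_const
  | succ j ih =>
    have hle : ∀ m : ℕ, MeasurableSet {y | entryIdxIter T D (j+1) y ≤ (m : ℕ∞)} := by
      intro m
      have : {y | entryIdxIter T D (j+1) y ≤ (m : ℕ∞)} = ⋃ n : ℕ, ⋃ (_ : n ≤ m),
          (entryIdxIter T D j ⁻¹' Set.Iio (n : ℕ∞) ∩ T^[n] ⁻¹' D) := by
        ext y
        simp only [mem_ofPred_eq, pk_entry_le, mem_iUnion, mem_inter_iff, mem_preimage, mem_Iio,
          exists_prop]
      rw [this]
      exact MeasurableSet.iUnion fun n => MeasurableSet.iUnion fun _ =>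
        (ih (MeasurableSet.of_discrete)).inter ((hT.iterate n) hD)
    rw [ENat.measurable_iff]
    intro n
    have : entryIdxIter T D (j+1) ⁻¹' {(n : ℕ∞)} = {y | entryIdxIter T D (j+1) y ≤ (n : ℕ∞)} \
        ⋃ m : ℕ, ⋃ (_ : m < n), {y | entryIdxIter T D (j+1) y ≤ (m : ℕ∞)} := by
      ext y
      simp only [mem_preimage, mem_singleton_iff, Set.mem_sdiff, mem_ofPred_eq, mem_iUnion,
        exists_prop, not_exists, not_and]
      generalize entryIdxIter T D (j+1) y = a
      constructor
      · rintro rfl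
        refine ⟨le_rfl, fun m hm h => ?_⟩
        have : n ≤ m := by exact_mod_cast h
        omega
      · rintro ⟨h1, h2⟩
        obtain ⟨b, rfl⟩ := ENat.ne_top_iff_exists.1
          (ne_top_of_le_ne_top (ENat.natCast_ne_top n) h1)
        have h1' : b ≤ n := by exact_mod_cast h1
        rcases h1'.lt_or_eq with h | h
        · exact absurd le_rfl (h2 b h)
        · rw [h]
    rw [this]
    exact (hle n).diff (MeasurableSet.iUnion fun m => MeasurableSet.iUnion fun _ => hle m)

theorem pk_birk_meas {Y : Type*} [MeasurableSpace Y] (T : Y → Y) (hT : Measurable T)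
    (r : Y → ℝ) (hr : Measurable r) (N : Y → ℕ∞) (hN : Measurable N) :
    Measurable (fun y => birkhoffE T r (N y) y) := by
  have h : Measurable (fun p : ℕ∞ × Y => birkhoffE T r p.1 p.2) := by
    refine measurable_from_prod_countable_right fun n => ?_
    unfold birkhoffE birkhoff
    by_cases hn : n = ⊤
    · simp only [hn, if_true]
      exact measurable_const
    · simp only [hn, if_false]
      exact ENNReal.measurable_ofReal.comp
        (Finset.measurable_sum _ fun i _ => hr.comp (hT.iterate i))
  exact h.comp (hN.prodMk measurable_id)

theorem pk_birk_rec {Y : Type*} (T : Y → Y) (r : Y → ℝ) (hr : ∀ y, 0 ≤ r y) (n : ℕ∞) (y : Y) :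
    birkhoffE T r (1 + n) y = ENNReal.ofReal (r y) + birkhoffE T r n (T y) := by
  induction n using ENat.recTopCoe with
  | top => simp [birkhoffE]
  | coe n =>
    have : (1 : ℕ∞) + (n : ℕ∞) = ((n + 1 : ℕ) : ℕ∞) := by push_cast; rw [add_comm]
    rw [this]
    unfold birkhoffE
    rw [if_neg (ENat.natCast_ne_top _), if_neg (ENat.natCast_ne_top _), ENat.toNat_natCast, ENat.toNat_natCast,
      ← ENNReal.ofReal_add (hr y)]
    · congr 1
      unfold birkhoff
      rw [Finset.sum_range_succ', add_comm]
      rfl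
    · exact Finset.sum_nonneg fun i _ => hr _

theorem pk_birk_mono {Y : Type*} (T : Y → Y) (r : Y → ℝ) (hr : ∀ y, 0 ≤ r y) {m n : ℕ∞}
    (h : m ≤ n) (y : Y) : birkhoffE T r m y ≤ birkhoffE T r n y := by
  unfold birkhoffE
  by_cases hn : n = ⊤
  · simp [hn]
  · rw [if_neg hn, if_neg (ne_top_of_le_ne_top hn h)]
    apply ENNReal.ofReal_le_ofReal
    unfold birkhoff
    apply Finset.sum_le_sum_of_subset_of_nonneg
    · exact Finset.range_mono (ENat.toNat_le_toNat h hn)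
    · intro i _ _; exact hr _

theorem pk_arith (a b R : ℝ≥0∞) (hR : R ≠ ⊤) : a + b - R = min a (a + b - R) + (b - R) := by
  rcases le_total R b with h | h
  · rw [(ENNReal.cancel_of_ne hR).add_tsub_assoc_of_le h, min_eq_left le_self_add]
  · rw [tsub_eq_zero_of_le h, add_zero, min_eq_right]
    rw [tsub_le_iff_right]; gcongr

theorem pk_trunc_mono (a b : ℝ≥0∞) (hab : b ≤ a) {m n : ℝ≥0∞} (h : m ≤ n) :
    min a m - min b m ≤ min a n - min b n := by
  rcases le_total b m with h1 | h1
  · rw [min_eq_left h1, min_eq_left (h1.trans h)]; gcongr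
  · rw [min_eq_right h1, min_eq_right (h1.trans hab)]; simp

theorem pk_trunc_sup (a b : ℝ≥0∞) (hab : b ≤ a) (ha : a ≠ ⊤) :
    ⨆ n : ℕ, (min a (n : ℝ≥0∞) - min b n) = a - b := by
  apply le_antisymm
  · refine iSup_le fun n => ?_
    have := pk_trunc_mono a b hab (le_top : (n : ℝ≥0∞) ≤ ⊤)
    simpa using this
  · obtain ⟨n, hn⟩ := ENNReal.exists_nat_gt ha
    refine le_iSup_of_le n ?_
    rw [min_eq_left hn.le, min_eq_left (hab.trans hn.le)]

theorem pk_sub_sup {Y : Type*} [MeasurableSpace Y] (ν : Measure Y)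
    (F G : Y → ℝ≥0∞) (hF : Measurable F) (hG : Measurable G) (h : ∀ y, G y ≤ F y)
    (hfin : ∀ᵐ y ∂ν, F y ≠ ⊤) [IsFiniteMeasure ν] :
    ∫⁻ y, (F y - G y) ∂ν =
      ⨆ n : ℕ, (∫⁻ y, min (F y) n ∂ν - ∫⁻ y, min (G y) n ∂ν) := by
  have h1 : ∫⁻ y, (F y - G y) ∂ν = ∫⁻ y, ⨆ n : ℕ, (min (F y) n - min (G y) n) ∂ν := by
    apply lintegral_congr_ae
    filter_upwards [hfin] with y hy
    rw [pk_trunc_sup _ _ (h y) hy]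
  rw [h1, lintegral_iSup]
  · congr 1
    funext n
    rw [lintegral_sub (hG.min measurable_const)]
    · refine ne_top_of_le_ne_top ?_ (lintegral_mono fun y => min_le_right (G y) (n : ℝ≥0∞))
      rw [lintegral_const]
      exact ENNReal.mul_ne_top (ENNReal.natCast_ne_top n) (measure_ne_top _ _)
    · exact Eventually.of_forall fun y => min_le_min_right _ (h y)
  · intro n; exact (hF.min measurable_const).sub (hG.min measurable_const)
  · intro m n hmn y
    exact pk_trunc_mono _ _ (h y) (by exact_mod_cast hmn)

/-- Palm–Khinchin equations for the `j`-th entry and return times of suspension semi-flows,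
concrete form: for every measurable `D`, `j ≥ 1` and `R ≥ 0`,
`∫_{Z_D^∞} min(r(y), max(S_{n_D^{(j)}(y)}(y) − R, 0)) dμ(y)`
`= ∫_D (max(S_{n_D^{(j)}(y)}(y) − R, 0) − max(S_{n_D^{(j−1)}(y)}(y) − R, 0)) dμ(y)`
(subtractions taken in `[0,∞]`, i.e. truncated at `0`; the right-hand integrand is
nonnegative). -/
theorem palm_khinchin_suspension_jth
    {Y : Type*} [MeasurableSpace Y] (μ : Measure Y) [IsProbabilityMeasure μ]
    (T : Y → Y) (hT : MeasurePreserving T μ μ)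
    (r : Y → ℝ) (hrm : Measurable r) (hri : Integrable r μ)
    (c : ℝ) (hc : 0 < c) (hcr : ∀ y, c ≤ r y)
    (D : Set Y) (hD : MeasurableSet D) (j : ℕ) (hj : 1 ≤ j) (R : ℝ) (hR : 0 ≤ R) :
    ∫⁻ y in ⋂ (k : ℕ) (_ : 1 ≤ k), ⋃ (i : ℕ) (_ : k ≤ i), T^[i] ⁻¹' D,
        min (ENNReal.ofReal (r y))
          (birkhoffE T r (entryIdxIter T D j y) y - ENNReal.ofReal R) ∂μ
      = ∫⁻ y in D,
          ((birkhoffE T r (entryIdxIter T D j y) y - ENNReal.ofReal R)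
            - (birkhoffE T r (entryIdxIter T D (j - 1) y) y - ENNReal.ofReal R)) ∂μ := by
  classical
  obtain ⟨j, rfl⟩ : ∃ i, j = i + 1 := ⟨j - 1, by omega⟩
  rw [Nat.add_sub_cancel]
  have hr : ∀ y, 0 ≤ r y := fun y => hc.le.trans (hcr y)
  set Z : Set Y := ⋂ (k : ℕ) (_ : 1 ≤ k), ⋃ (i : ℕ) (_ : k ≤ i), T^[i] ⁻¹' D with hZdef
  have hmem : ∀ y, y ∈ Z ↔ ∀ k : ℕ, 1 ≤ k → ∃ i, k ≤ i ∧ T^[i] y ∈ D := by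
    intro y; simp [hZdef]
  have hZm : MeasurableSet Z := by
    refine MeasurableSet.iInter fun k => MeasurableSet.iInter fun _ =>
      MeasurableSet.iUnion fun i => MeasurableSet.iUnion fun _ => (hT.measurable.iterate i) hD
  have hZT : T ⁻¹' Z = Z := by
    ext y
    rw [mem_preimage, hmem, hmem]
    constructor
    · intro h k hk
      obtain ⟨i, hi, hD⟩ := h k hk
      exact ⟨i+1, by omega, hD⟩
    · intro h k hk
      obtain ⟨i, hi, hD⟩ := h (k+1) (by omega)
      obtain ⟨i, rfl⟩ : ∃ l, i = l + 1 := ⟨i - 1, by omega⟩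
      exact ⟨i, by omega, hD⟩
  have hDZ : ∀ᵐ y ∂μ, y ∈ D → y ∈ Z := by
    filter_upwards [hT.conservative.ae_mem_imp_frequently_image_mem hD.nullMeasurableSet]
      with y hy hyD
    rw [hmem]
    intro k _
    exact (frequently_atTop.1 (hy hyD) k)
  set A : ℕ → Y → ℝ≥0∞ := fun i y =>
    birkhoffE T r (entryIdxIter T D i y) y - ENNReal.ofReal R with hA
  have hAm : ∀ i, Measurable (A i) := fun i =>
    (pk_birk_meas T hT.measurable r hrm _ (pk_entry_meas T hT.measurable D hD i)).sub
      measurable_const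
  have hAmono : ∀ y, A j y ≤ A (j+1) y := fun y =>
    tsub_le_tsub_right (pk_birk_mono T r hr (pk_entry_mono T D j y) y) _
  have hAfin : ∀ i, ∀ y ∈ Z, A i y ≠ ⊤ := by
    intro i y hy
    refine ne_top_of_le_ne_top ?_ (tsub_le_self : A i y ≤ _)
    unfold birkhoffE
    rw [if_neg (pk_entry_fin T D y ((hmem y).1 hy) i)]
    exact ENNReal.ofReal_ne_top
  set G : Y → ℝ≥0∞ := fun y => if y ∈ D then A j y else A (j+1) y with hG
  have hGm : Measurable G := Measurable.ite hD (hAm j) (hAm (j+1))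
  have hGle : ∀ y, G y ≤ A (j+1) y := by
    intro y
    simp only [hG]
    split_ifs
    · exact hAmono y
    · exact le_rfl
  have hrec : ∀ y, A (j+1) y = min (ENNReal.ofReal (r y)) (A (j+1) y) + G (T y) := by
    intro y
    simp only [hA, hG]
    rw [pk_entry_rec T D j y, pk_birk_rec T r hr]
    split_ifs
    · exact pk_arith _ _ _ ENNReal.ofReal_ne_top
    · exact pk_arith _ _ _ ENNReal.ofReal_ne_top
  have hGT : ∀ y, G (T y) ≤ A (j+1) y := fun y => by
    rw [hrec y]; exact le_add_self
  have hfinZ : ∀ᵐ y ∂(μ.restrict Z), A (j+1) y ≠ ⊤ :=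
    (ae_restrict_iff' hZm).2 (Eventually.of_forall (hAfin (j+1)))
  have hL : ∫⁻ y in Z, min (ENNReal.ofReal (r y)) (A (j+1) y) ∂μ
      = ∫⁻ y in Z, (A (j+1) y - G (T y)) ∂μ := by
    apply lintegral_congr_ae
    filter_upwards [hfinZ] with y hy
    refine ENNReal.eq_sub_of_add_eq (ne_top_of_le_ne_top hy (hGT y)) (hrec y).symm
  have hR' : ∫⁻ y in D, (A (j+1) y - A j y) ∂μ = ∫⁻ y in Z, (A (j+1) y - G y) ∂μ := by
    rw [← lintegral_indicator hD, ← lintegral_indicator hZm]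
    apply lintegral_congr_ae
    filter_upwards [hDZ] with y hy
    by_cases hyD : y ∈ D
    · simp [hyD, hy hyD, hG]
    · by_cases hyZ : y ∈ Z
      · simp [hyD, hyZ, hG]
      · simp [hyD, hyZ]
  change ∫⁻ y in Z, min (ENNReal.ofReal (r y)) (A (j+1) y) ∂μ
    = ∫⁻ y in D, (A (j+1) y - A j y) ∂μ
  rw [hL, hR', pk_sub_sup _ _ (fun y => G (T y)) (hAm _) (hGm.comp hT.measurable) hGT hfinZ,
    pk_sub_sup _ _ _ (hAm _) hGm hGle hfinZ]
  congr 1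
  funext n
  congr 1
  have := hT.setLIntegral_comp_preimage hZm (f := fun y => min (G y) (n : ℝ≥0∞))
    (hGm.min measurable_const)
  rw [hZT] at this
  exact this
end

section
/- Discrete Palm–Khinchin (Haydn–Lacroix–Vaienti) identity for non-ergodic maps, first entry time: for every measurable set D ∈ 𝒜 and every integer k ≥ 0, μ({y ∈ Y : k < n_D(y) < ∞}) = Σ_{i=k}^∞ μ({y ∈ D : n_D(y) > i}). -/
open MeasureTheory Set Filter
open scoped ENNReal ENat

theorem lt_entryIdx_iff {Y : Type*} (T : Y → Y) (D : Set Y) (y : Y) (i : ℕ) :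
    (i : ℕ∞) < entryIdx T D y ↔ ∀ n, 1 ≤ n → n ≤ i → T^[n] y ∉ D := by
  have h1 : (i : ℕ∞) < entryIdx T D y ↔ ((i + 1 : ℕ) : ℕ∞) ≤ entryIdx T D y := by
    rw [Nat.cast_add, Nat.cast_one, ENat.add_one_le_iff (ENat.natCast_ne_top i)]
  rw [h1, entryIdx, le_sInf_iff]
  constructor
  · intro h n hn hi hD
    have := h n ⟨n, hn, hD, rfl⟩
    have := Nat.cast_le.1 this
    omega
  · rintro h _ ⟨n, hn, hD, rfl⟩
    refine Nat.cast_le.2 ?_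
    by_contra hc
    exact h n hn (by omega) hD

theorem lt_entryIdx_succ {Y : Type*} (T : Y → Y) (D : Set Y) (y : Y) (i : ℕ) :
    ((i + 1 : ℕ) : ℕ∞) < entryIdx T D y ↔ (i : ℕ∞) < entryIdx T D (T y) ∧ T y ∉ D := by
  rw [lt_entryIdx_iff, lt_entryIdx_iff]
  constructor
  · intro h
    exact ⟨fun n hn hi => h (n + 1) (by omega) (by omega), h 1 le_rfl (by omega)⟩
  · rintro ⟨h, h0⟩ n hn hi
    obtain ⟨m, rfl⟩ : ∃ m, n = m + 1 := ⟨n - 1, by omega⟩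
    rcases Nat.eq_zero_or_pos m with rfl | hm
    · exact h0
    · exact h m hm (by omega)

theorem measurableSet_lt_entryIdx {Y : Type*} [MeasurableSpace Y] (T : Y → Y)
    (hT : Measurable T) (D : Set Y) (hD : MeasurableSet D) (i : ℕ) :
    MeasurableSet {y | (i : ℕ∞) < entryIdx T D y} := by
  induction i with
  | zero =>
    have : {y | ((0 : ℕ) : ℕ∞) < entryIdx T D y} = univ := by
      ext y
      simp only [mem_ofPred_eq, mem_univ, iff_true]
      rw [lt_entryIdx_iff]
      intro n h1 h2
      omega
    rw [this]
    exact MeasurableSet.univ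
  | succ i ih =>
    have : {y | ((i + 1 : ℕ) : ℕ∞) < entryIdx T D y}
        = T ⁻¹' ({y | (i : ℕ∞) < entryIdx T D y} \ D) := by
      ext y
      exact lt_entryIdx_succ T D y i
    rw [this]
    exact hT (ih.diff hD)

/-- Discrete Palm–Khinchin (Haydn–Lacroix–Vaienti) identity for non-ergodic maps, first
entry time: for every measurable `D` and `k ≥ 0`,
`μ({y : k < n_D(y) < ∞}) = ∑_{i=k}^∞ μ({y ∈ D : n_D(y) > i})`. -/
theorem discrete_palm_khinchin
    {Y : Type*} [MeasurableSpace Y] (μ : Measure Y) [IsProbabilityMeasure μ]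
    (T : Y → Y) (hT : MeasurePreserving T μ μ)
    (D : Set Y) (hD : MeasurableSet D) (k : ℕ) :
    μ {y : Y | (k : ℕ∞) < entryIdx T D y ∧ entryIdx T D y ≠ ⊤}
      = ∑' i : ℕ, μ {y : Y | y ∈ D ∧ ((k + i : ℕ) : ℕ∞) < entryIdx T D y} := by
  set A : ℕ → Set Y := fun i => {y | (i : ℕ∞) < entryIdx T D y} with hA
  have hm : ∀ i, MeasurableSet (A i) := measurableSet_lt_entryIdx T hT.measurable D hD
  have hpre : ∀ i, A (i + 1) = T ⁻¹' (A i \ D) := fun i => by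
    ext y
    exact lt_entryIdx_succ T D y i
  have hanti : Antitone A := fun i j hij y hy => by
    have hy2 : (j : ℕ∞) < entryIdx T D y := hy
    have hy3 : (i : ℕ∞) < entryIdx T D y := lt_of_le_of_lt (Nat.cast_le.2 hij) hy2
    exact hy3
  have hstep : ∀ i, μ (A i \ A (i + 1)) = μ (A i ∩ D) := fun i => by
    have e1 : μ (A (i + 1)) = μ (A i \ D) := by
      rw [hpre, hT.measure_preimage ((hm i).diff hD).nullMeasurableSet]
    have e2 := measure_inter_add_diff (μ := μ) (A i) hD
    have e3 := measure_inter_add_diff (μ := μ) (A i) (hm (i + 1))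
    rw [inter_eq_right.2 (hanti (Nat.le_succ i)), e1, add_comm, ← e2] at e3
    exact (ENNReal.add_left_inj (measure_ne_top μ _)).1 e3
  have hU : {y : Y | (k : ℕ∞) < entryIdx T D y ∧ entryIdx T D y ≠ ⊤}
      = ⋃ i : ℕ, A (k + i) \ A (k + i + 1) := by
    ext y
    simp only [hA, mem_ofPred_eq, mem_iUnion, mem_diff, not_lt]
    constructor
    · rintro ⟨h1, h2⟩
      obtain ⟨n, hn⟩ := ENat.ne_top_iff_exists.1 h2
      rw [← hn] at h1 ⊢
      have h1 := Nat.cast_lt.1 h1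
      exact ⟨n - k - 1, Nat.cast_lt.2 (by omega), Nat.cast_le.2 (by omega)⟩
    · rintro ⟨i, h1, h2⟩
      exact ⟨lt_of_le_of_lt (Nat.cast_le.2 (by omega)) h1,
        ne_top_of_le_ne_top (ENat.natCast_ne_top _) h2⟩
  have hdis : Pairwise (Function.onFun Disjoint fun i : ℕ => A (k + i) \ A (k + i + 1)) := by
    have key : ∀ i j : ℕ, i < j →
        Disjoint (A (k + i) \ A (k + i + 1)) (A (k + j) \ A (k + j + 1)) := fun i j hij =>
      Set.disjoint_left.2 fun y h1 h2 => h1.2 (hanti (by omega) h2.1)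
    intro i j hij
    rcases lt_or_gt_of_ne hij with h | h
    · exact key i j h
    · exact (key j i h).symm
  rw [hU, measure_iUnion hdis fun i => (hm _).diff (hm _)]
  refine tsum_congr fun i => ?_
  rw [hstep, inter_comm]
  rfl
end

section
/- Discrete Palm–Khinchin identity for non-ergodic maps, j-th entry time: for every measurable set D ∈ 𝒜, every integer j ≥ 1 and every integer k ≥ 0, μ({y ∈ Y : k < n_D^{(j)}(y) < ∞}) = Σ_{i=k}^∞ ( μ({y ∈ D : n_D^{(j)}(y) > i}) − μ({y ∈ D : n_D^{(j−1)}(y) > i}) ), each summand being nonnegative. -/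
open MeasureTheory Set Filter
open scoped ENNReal ENat

open Classical in
noncomputable def cntD {Y : Type*} (T : Y → Y) (D : Set Y) (n : ℕ) (y : Y) : ℕ :=
  ∑ m ∈ Finset.range n, (if T^[m+1] y ∈ D then 1 else 0)

open Classical in
lemma cntD_succ {Y : Type*} (T : Y → Y) (D : Set Y) (n : ℕ) (y : Y) :
    cntD T D (n+1) y = cntD T D n y + (if T^[n+1] y ∈ D then 1 else 0) := by
  simp only [cntD, Finset.sum_range_succ]

open Classical in
lemma cntD_succ' {Y : Type*} (T : Y → Y) (D : Set Y) (n : ℕ) (y : Y) :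
    cntD T D (n+1) y = cntD T D n (T y) + (if T y ∈ D then 1 else 0) := by
  unfold cntD
  rw [Finset.sum_range_succ']
  rfl

lemma measurable_cntD {Y : Type*} [MeasurableSpace Y] (T : Y → Y) (hT : Measurable T)
    (D : Set Y) (hD : MeasurableSet D) (n : ℕ) : Measurable (cntD T D n) := by
  classical
  unfold cntD
  refine Finset.measurable_sum _ (fun m _ => ?_)
  exact Measurable.ite ((hT.iterate (m+1)) hD) measurable_const measurable_const

lemma cntD_lt_iff {Y : Type*} (T : Y → Y) (D : Set Y) (j i : ℕ) (y : Y) :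
    cntD T D i y < j + 1 ↔ ∀ n, n < i → ¬ (j ≤ cntD T D n y ∧ T^[n+1] y ∈ D) := by
  induction i with
  | zero => simp [cntD]
  | succ i ih =>
    have h1 : cntD T D (i+1) y < j + 1 ↔
        cntD T D i y < j + 1 ∧ ¬ (j ≤ cntD T D i y ∧ T^[i+1] y ∈ D) := by
      rw [cntD_succ]
      split_ifs with h <;> simp only [h, and_true, and_false, not_false_eq_true] <;> omega
    rw [h1, ih]
    constructor
    · rintro ⟨h, h'⟩ n hn
      rcases Nat.lt_succ_iff_lt_or_eq.mp hn with h2 | rfl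
      · exact h n h2
      · exact h'
    · intro h
      exact ⟨fun n hn => h n (by omega), h i (by omega)⟩

lemma lt_entry_iff {Y : Type*} (T : Y → Y) (D : Set Y) (j : ℕ) (y : Y) :
    ∀ i : ℕ, (i : ℕ∞) < entryIdxIter T D j y ↔ cntD T D i y < j := by
  induction j with
  | zero => intro i; simp [entryIdxIter]
  | succ j ih =>
    intro i
    rw [cntD_lt_iff, ← not_iff_not, not_lt]
    have key : ∀ n : ℕ, entryIdxIter T D j y < ((n+1 : ℕ) : ℕ∞) ↔ j ≤ cntD T D n y := by
      intro n
      rw [← not_lt (a := cntD T D n y), ← ih n, not_lt]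
      push_cast
      exact ENat.lt_add_one_iff (ENat.coe_ne_top n)
    push Not
    rw [← Order.lt_add_one_iff_of_not_isMax (by simp), entryIdxIter, sInf_lt_iff]
    constructor
    · rintro ⟨m, ⟨n, h1, h2, rfl⟩, h3⟩
      have h3' : n < i + 1 := by exact_mod_cast h3
      cases n with
      | zero => simp at h1
      | succ n => exact ⟨n, by omega, (key n).1 h1, h2⟩
    · rintro ⟨n, h1, h2, h3⟩
      refine ⟨_, ⟨n+1, (key n).2 h2, h3, rfl⟩, ?_⟩
      have : n + 1 < i + 1 := by omega
      exact_mod_cast this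

/-- Discrete Palm–Khinchin identity for non-ergodic maps, `j`-th entry time: for every
measurable `D`, `j ≥ 1` and `k ≥ 0`,
`μ({y : k < n_D^{(j)}(y) < ∞}) = ∑_{i=k}^∞ (μ({y ∈ D : n_D^{(j)}(y) > i}) − μ({y ∈ D : n_D^{(j−1)}(y) > i}))`,
each summand being nonnegative (subtraction taken in `[0,∞]`, i.e. truncated at `0`). -/
theorem discrete_palm_khinchin_jth
    {Y : Type*} [MeasurableSpace Y] (μ : Measure Y) [IsProbabilityMeasure μ]
    (T : Y → Y) (hT : MeasurePreserving T μ μ)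
    (D : Set Y) (hD : MeasurableSet D) (j : ℕ) (hj : 1 ≤ j) (k : ℕ) :
    μ {y : Y | (k : ℕ∞) < entryIdxIter T D j y ∧ entryIdxIter T D j y ≠ ⊤}
      = ∑' i : ℕ,
          (μ {y : Y | y ∈ D ∧ ((k + i : ℕ) : ℕ∞) < entryIdxIter T D j y}
            - μ {y : Y | y ∈ D ∧ ((k + i : ℕ) : ℕ∞) < entryIdxIter T D (j - 1) y}) := by
  obtain ⟨j, rfl⟩ : ∃ j', j = j' + 1 := ⟨j - 1, by omega⟩
  have hmc := measurable_cntD T hT.measurable D hD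
  simp only [Nat.add_sub_cancel, lt_entry_iff]
  have hmlt : ∀ a i, MeasurableSet {y | cntD T D i y < a} := fun a i =>
    measurableSet_lt (hmc i) measurable_const
  have hmD : ∀ a i, MeasurableSet {y | y ∈ D ∧ cntD T D i y < a} := fun a i =>
    hD.inter (hmlt a i)
  have hU : {y : Y | cntD T D k y < j + 1 ∧ entryIdxIter T D (j+1) y ≠ ⊤}
      = ⋃ i : ℕ, {y | cntD T D (k+i) y < j + 1} \ {y | cntD T D (k+i+1) y < j + 1} := by
    ext y
    simp only [mem_setOf_eq, mem_iUnion, mem_diff, ← lt_entry_iff]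
    constructor
    · rintro ⟨h1, h2⟩
      obtain ⟨n, hn⟩ := ENat.ne_top_iff_exists.mp h2
      rw [← hn] at h1 ⊢
      have h1' : k < n := by exact_mod_cast h1
      refine ⟨n - k - 1, ?_, ?_⟩
      · have : k + (n-k-1) < n := by omega
        exact_mod_cast this
      · have : ¬ (k + (n-k-1) + 1 < n) := by omega
        exact_mod_cast this
    · rintro ⟨i, h1, h2⟩
      refine ⟨lt_of_le_of_lt ?_ h1, ?_⟩
      · exact_mod_cast Nat.le_add_right k i
      · intro h
        rw [h] at h2
        exact h2 (ENat.coe_lt_top _)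
  have hmono : ∀ y, Monotone (fun i => cntD T D i y) := fun y =>
    monotone_nat_of_le_succ (fun n => by rw [cntD_succ]; omega)
  rw [hU, measure_iUnion]
  · refine tsum_congr (fun i => ?_)
    rw [measure_diff _ (hmlt _ _).nullMeasurableSet (measure_ne_top _ _),
      ← measure_diff _ (hmD _ _).nullMeasurableSet (measure_ne_top _ _)]
    · rw [← hT.measure_preimage (hmlt (j+1) (k+i)).nullMeasurableSet,
        ← measure_diff _ (hmlt _ _).nullMeasurableSet (measure_ne_top _ _)]
      · rw [← hT.measure_preimage
          ((hmD _ _).diff (hmD _ _)).nullMeasurableSet]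
        congr 1
        ext y
        simp only [mem_diff, mem_preimage, mem_setOf_eq, cntD_succ', mem_inter_iff]
        by_cases h : T y ∈ D <;> simp [h] <;> omega
      · intro y hy
        simp only [mem_setOf_eq, cntD_succ', mem_preimage] at hy ⊢
        omega
    · rintro y ⟨h1, h2⟩
      exact ⟨h1, by omega⟩
    · intro y hy
      have := hmono y (Nat.le_succ (k+i))
      simp only [mem_setOf_eq] at hy this ⊢
      exact lt_of_le_of_lt this hy
  · refine (pairwise_disjoint_on _).2 (fun a b hab => ?_)
    rw [Set.disjoint_left]
    rintro y ⟨_, h2⟩ ⟨h3, _⟩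
    have := hmono y (show k + a + 1 ≤ k + b by omega)
    exact h2 (lt_of_le_of_lt this h3)
  · exact fun i => (hmlt _ _).diff (hmlt _ _)
end

section
/- Equivalence of convergence of entry-time and return-time distributions (distilled form of the Haydn–Lacroix–Vaienti theorem): let (ρ_n) be a sequence of Borel probability measures on [0,∞) with sup_n ∫_{[0,∞)} u dρ_n(u) < ∞, and let ρ be a Borel probability measure on [0,∞) with tail function F(R) = ρ((R,∞)). Then the following are equivalent: (i) for every R ≥ 0, ∫_0^R ρ_n((u,∞)) du → ∫_0^R F(u) du as n → ∞; (ii) ρ_n converges weakly to ρ, i.e. ∫ g dρ_n → ∫ g dρ for every bounded continuous g : [0,∞) → ℝ. -/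
open MeasureTheory Set Filter
open scoped ENNReal

open Topology

noncomputable def trunc (μ : Measure ℝ) (R : ℝ) : ℝ := ∫ x, min (max 0 x) R ∂μ

lemma trunc_integrable (μ : Measure ℝ) [IsProbabilityMeasure μ] (R : ℝ) :
    Integrable (fun x : ℝ => min (max 0 x) R) μ := by
  refine Integrable.of_bound (C := |R|) (by fun_prop) (ae_of_all _ fun x => ?_)
  rw [Real.norm_eq_abs]
  have := le_max_left 0 x
  rcases le_total (max 0 x) R with h | h
  · rw [min_eq_left h, abs_of_nonneg this]; exact h.trans (le_abs_self R)
  · rw [min_eq_right h]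

lemma trunc_eq (μ : Measure ℝ) [IsProbabilityMeasure μ] (R : ℝ) (hR : 0 ≤ R) :
    ∫⁻ u in Set.Ioc (0 : ℝ) R, μ (Set.Ioi u) ∂volume = ENNReal.ofReal (trunc μ R) := by
  have hnn : ∀ x : ℝ, 0 ≤ min (max 0 x) R := fun x => le_min (le_max_left _ _) hR
  rw [trunc, ofReal_integral_eq_lintegral_ofReal (trunc_integrable μ R) (ae_of_all _ hnn),
    lintegral_eq_lintegral_meas_lt μ (ae_of_all _ hnn) (by fun_prop),
    setLIntegral_congr (Ioo_ae_eq_Ioc (a := (0:ℝ)) (b := R)).symm,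
    ← lintegral_indicator measurableSet_Ioo, ← lintegral_indicator measurableSet_Ioi]
  congr 1
  ext t
  by_cases h0 : 0 < t
  · by_cases h1 : t < R
    · rw [indicator_of_mem (show t ∈ Ioo 0 R from ⟨h0, h1⟩), indicator_of_mem (show t ∈ Ioi 0 from h0)]
      congr 1
      ext x
      simp only [mem_Ioi, mem_ofPred_eq, lt_min_iff, lt_max_iff]
      grind
    · rw [indicator_of_notMem (fun h => h1 h.2), indicator_of_mem (show t ∈ Ioi 0 from h0)]
      symm
      convert measure_empty (μ := μ)
      ext x
      simp only [mem_ofPred_eq, lt_min_iff, mem_empty_iff_false, iff_false]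
      grind
  · rw [indicator_of_notMem (fun h => h0 h.1), indicator_of_notMem (show t ∉ Ioi 0 from h0)]

lemma trunc_neg (μ : Measure ℝ) [IsProbabilityMeasure μ] (R : ℝ) (hR : R ≤ 0) :
    trunc μ R = R := by
  have : ∀ x : ℝ, min (max 0 x) R = R := fun x => min_eq_right (hR.trans (le_max_left _ _))
  simp [trunc, this]

lemma trunc_bounds (μ : Measure ℝ) [IsProbabilityMeasure μ] (hs : μ (Iio 0) = 0)
    {a b : ℝ} (hab : a < b) :
    (b - a) * μ.real (Ioi b) ≤ trunc μ b - trunc μ a ∧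
      trunc μ b - trunc μ a ≤ (b - a) * μ.real (Ioi a) := by
  have hae : ∀ᵐ x ∂μ, 0 ≤ x := by
    rw [ae_iff]; convert hs using 2; ext x; simp
  have hi : ∀ c : ℝ, Integrable ((Ioi c).indicator (fun _ : ℝ => b - a)) μ := fun c =>
    (integrable_const _).indicator measurableSet_Ioi
  have he : ∀ c : ℝ, (b - a) * μ.real (Ioi c) = ∫ x, (Ioi c).indicator (fun _ : ℝ => b - a) x ∂μ := by
    intro c
    rw [integral_indicator_const _ measurableSet_Ioi, smul_eq_mul, mul_comm]
  have hsub : trunc μ b - trunc μ a = ∫ x, (min (max 0 x) b - min (max 0 x) a) ∂μ :=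
    (integral_sub (trunc_integrable μ b) (trunc_integrable μ a)).symm
  have hI := (trunc_integrable μ b).sub (trunc_integrable μ a)
  rw [he, he, hsub]
  constructor
  · refine integral_mono_ae (hi b) hI ?_
    filter_upwards [hae] with x hx
    simp only [indicator_apply, mem_Ioi, Pi.sub_apply, max_eq_right hx]
    grind
  · refine integral_mono_ae hI (hi a) ?_
    filter_upwards [hae] with x hx
    simp only [indicator_apply, mem_Ioi, Pi.sub_apply, max_eq_right hx]
    grind

lemma tail_eq (μ : Measure ℝ) [IsProbabilityMeasure μ] (c : ℝ) :
    μ.real (Ioi c) = 1 - ProbabilityTheory.cdf μ c := by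
  rw [ProbabilityTheory.cdf_eq_real, ← compl_Iic, probReal_compl_eq_one_sub measurableSet_Iic]

lemma tail_cont (μ : Measure ℝ) [IsProbabilityMeasure μ] (c : ℝ) (hc : μ {c} = 0) :
    ContinuousAt (fun u => μ.real (Ioi u)) c := by
  simp_rw [tail_eq]
  refine continuousAt_const.sub ?_
  have hm := ProbabilityTheory.monotone_cdf μ
  rw [hm.continuousAt_iff_leftLim_eq_rightLim, StieltjesFunction.rightLim_eq]
  have h := StieltjesFunction.measure_singleton (ProbabilityTheory.cdf μ) c
  rw [ProbabilityTheory.measure_cdf, hc] at h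
  have h2 := ENNReal.ofReal_eq_zero.1 h.symm
  have h3 := hm.leftLim_le (le_refl c)
  linarith

lemma tail_tendsto (ρs : ℕ → Measure ℝ) (ρ : Measure ℝ)
    [∀ n, IsProbabilityMeasure (ρs n)] [IsProbabilityMeasure ρ]
    (hs : ∀ n, ρs n (Iio 0) = 0) (hρ : ρ (Iio 0) = 0)
    (h : ∀ R, Tendsto (fun n => trunc (ρs n) R) atTop (𝓝 (trunc ρ R)))
    (c : ℝ) (hc : ρ {c} = 0) :
    Tendsto (fun n => (ρs n).real (Ioi c)) atTop (𝓝 (ρ.real (Ioi c))) := by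
  have hcont := tail_cont ρ c hc
  rw [tendsto_order]
  constructor
  · intro r hr
    have h1 : ∀ᶠ u in 𝓝[>] c, r < ρ.real (Ioi u) :=
      (hcont.eventually (lt_mem_nhds hr)).filter_mono nhdsWithin_le_nhds
    obtain ⟨b, hb, hcb⟩ := (h1.and self_mem_nhdsWithin).exists
    have hcb : c < b := hcb
    have hb' := (trunc_bounds ρ hρ hcb).1
    have h2 : (b - c) * r < trunc ρ b - trunc ρ c := by nlinarith
    filter_upwards [((h b).sub (h c)).eventually (lt_mem_nhds h2)] with n hn
    have := (trunc_bounds (ρs n) (hs n) hcb).2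
    exact lt_of_mul_lt_mul_left (hn.trans_le this) (by linarith)
  · intro r hr
    have h1 : ∀ᶠ u in 𝓝[<] c, ρ.real (Ioi u) < r :=
      (hcont.eventually (gt_mem_nhds hr)).filter_mono nhdsWithin_le_nhds
    obtain ⟨b, hb, hcb⟩ := (h1.and self_mem_nhdsWithin).exists
    have hcb : b < c := hcb
    have hb' := (trunc_bounds ρ hρ hcb).2
    have h2 : trunc ρ c - trunc ρ b < (c - b) * r := by nlinarith
    filter_upwards [((h c).sub (h b)).eventually (gt_mem_nhds h2)] with n hn
    have := (trunc_bounds (ρs n) (hs n) hcb).1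
    exact lt_of_mul_lt_mul_left (this.trans_lt hn) (by linarith)

lemma exists_good (ρ : Measure ℝ) [IsProbabilityMeasure ρ] {a b : ℝ} (h : a < b) :
    ∃ c ∈ Ioo a b, ρ {c} = 0 := by
  have hcount : {x : ℝ | 0 < ρ {x}}.Countable :=
    Measure.countable_meas_pos_of_disjoint_iUnion (fun x => measurableSet_singleton x)
      (fun x y hxy => by simpa using hxy)
  obtain ⟨c, hc, hc'⟩ := (hcount.dense_compl ℝ).exists_between h
  exact ⟨c, hc', by simpa using hc⟩

lemma weak_of_trunc (ρs : ℕ → ProbabilityMeasure ℝ) (ρ : ProbabilityMeasure ℝ)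
    (h : ∀ c, (ρ : Measure ℝ) {c} = 0 →
      Tendsto (fun n => (ρs n : Measure ℝ).real (Ioi c)) atTop (𝓝 ((ρ : Measure ℝ).real (Ioi c)))) :
    Tendsto ρs atTop (𝓝 ρ) := by
  have hIoc : ∀ (μ : ProbabilityMeasure ℝ) (a b : ℝ), a < b → (μ : Measure ℝ).real (Ioc a b) =
      (μ : Measure ℝ).real (Ioi a) - (μ : Measure ℝ).real (Ioi b) := by
    intro μ a b hab
    rw [← Ioi_sdiff_Ioi, measureReal_sdiff (Ioi_subset_Ioi hab.le) measurableSet_Ioi]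
  refine IsPiSystem.tendsto_probabilityMeasure_of_tendsto_of_mem
    (S := {s | ∃ a b, a < b ∧ (ρ : Measure ℝ) {a} = 0 ∧ (ρ : Measure ℝ) {b} = 0 ∧ s = Ioc a b})
    ?_ ?_ ?_ ?_
  · rintro _ ⟨a, b, -, ha, hb, rfl⟩ _ ⟨a', b', -, ha', hb', rfl⟩ hne
    rw [Ioc_inter_Ioc] at hne ⊢
    refine ⟨_, _, nonempty_Ioc.1 hne, ?_, ?_, rfl⟩
    · rcases max_choice a a' with h | h <;> simpa [h]
    · rcases min_choice b b' with h | h <;> simpa [h]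
  · rintro _ ⟨a, b, -, -, -, rfl⟩
    exact measurableSet_Ioc
  · intro u hu x hx
    obtain ⟨l, r, ⟨h1, h2⟩, hlr⟩ := mem_nhds_iff_exists_Ioo_subset.1 (hu.mem_nhds hx)
    obtain ⟨a, ha, ha0⟩ := exists_good (ρ : Measure ℝ) h1
    obtain ⟨b, hb, hb0⟩ := exists_good (ρ : Measure ℝ) h2
    refine ⟨_, ⟨a, b, ha.2.trans hb.1, ha0, hb0, rfl⟩, Ioc_mem_nhds ha.2 hb.1, ?_⟩
    exact fun y hy => hlr ⟨ha.1.trans hy.1, hy.2.trans_lt hb.2⟩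
  · rintro _ ⟨a, b, hab, ha, hb, rfl⟩
    have := (h a ha).sub (h b hb)
    simp_rw [← hIoc _ a b hab] at this
    simpa using this

/-- Equivalence of convergence of entry-time and return-time distributions (distilled form
of the Haydn–Lacroix–Vaienti theorem): for Borel probability measures `ρ_n`, `ρ` on `[0,∞)`
(modelled as probability measures on `ℝ` giving no mass to `(-∞,0)`) with uniformly bounded
means, the convergence `∫_0^R ρ_n((u,∞)) du → ∫_0^R ρ((u,∞)) du` for every `R ≥ 0` is
equivalent to the weak convergence `ρ_n → ρ`. -/
theorem entry_return_convergence_equiv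
    (ρseq : ℕ → Measure ℝ) (ρ : Measure ℝ)
    [∀ n, IsProbabilityMeasure (ρseq n)] [IsProbabilityMeasure ρ]
    (hsupp : ∀ n, ρseq n (Set.Iio (0 : ℝ)) = 0) (hρsupp : ρ (Set.Iio (0 : ℝ)) = 0)
    (hmean : (⨆ n, ∫⁻ u, ENNReal.ofReal u ∂(ρseq n)) ≠ ⊤) :
    (∀ R : ℝ, 0 ≤ R →
        Filter.Tendsto (fun n => ∫⁻ u in Set.Ioc (0 : ℝ) R, ρseq n (Set.Ioi u) ∂volume)
          Filter.atTop (nhds (∫⁻ u in Set.Ioc (0 : ℝ) R, ρ (Set.Ioi u) ∂volume)))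
      ↔ (∀ g : ℝ → ℝ, Continuous g → (∃ M : ℝ, ∀ x : ℝ, |g x| ≤ M) →
          Filter.Tendsto (fun n => ∫ x, g x ∂(ρseq n)) Filter.atTop
            (nhds (∫ x, g x ∂ρ))) := by
  constructor
  · intro h
    have ht : ∀ R, Tendsto (fun n => trunc (ρseq n) R) atTop (𝓝 (trunc ρ R)) := by
      intro R
      rcases le_total R 0 with hR | hR
      · simp only [trunc_neg _ _ hR]; exact tendsto_const_nhds
      · have hnn : ∀ (μ : Measure ℝ), 0 ≤ trunc μ R := fun μ =>
          integral_nonneg fun x => le_min (le_max_left _ _) hR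
        have := h R hR
        simp only [trunc_eq _ R hR] at this
        have := (ENNReal.tendsto_toReal ENNReal.ofReal_ne_top).comp this
        simpa [Function.comp_def, ENNReal.toReal_ofReal (hnn _)] using this
    have hw := weak_of_trunc (fun n => ⟨ρseq n, inferInstance⟩) ⟨ρ, inferInstance⟩
      (fun c hc => tail_tendsto ρseq ρ hsupp hρsupp ht c hc)
    replace hw := ProbabilityMeasure.tendsto_iff_forall_integral_tendsto.1 hw
    rintro g hg ⟨M, hM⟩
    exact hw (BoundedContinuousFunction.ofNormedAddCommGroup g hg M hM)
  · intro h R hR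
    simp only [trunc_eq _ R hR]
    refine ENNReal.tendsto_ofReal (h (fun x => min (max 0 x) R) (by fun_prop) ⟨R, fun x => ?_⟩)
    rw [abs_of_nonneg (le_min (le_max_left _ _) hR)]
    exact min_le_right _ _
end
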